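/- arXiv:1807.02379 — 9 statements merged into one kernel-verified Lean document; each statement's English description precedes it below -/
import Mathlib

section
/- Let f, g ∈ A be non-constant polynomials with n = deg f, and let g have prime factorization g = α P₁^{e₁} ⋯ P_r^{e_r} with α ∈ F_q*, each P_i monic irreducible of degree d_i ≥ 1 and each e_i ≥ 1. Then the number M(f,g) of congruence preserving functions from A_f to A_g equals |g|^{q^n} / ∏_{i=1}^r |P_i|^{(q−1) Σ_{k=1}^{n−1} q^k · min{e_i, ⌊k/d_i⌋}}; equivalently, M(f,g) = q^{q^n · deg g − Σ_{i=1}^r d_i (q−1) Σ_{k=1}^{n−1} q^k min{e_i, ⌊k/d_i⌋}}. -/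
open Polynomial

noncomputable section

variable {F : Type*} [Field F] [Fintype F]

/-- `σ : A_f → A_g` is congruence preserving: for all `h₁, h₂` in the complete set of
representatives `𝒜_f = {h : deg h < deg f} ∪ {0}` and all `h ∣ g`, if `h₁ ≡ h₂ (mod h)`
then `σ(h̄₁) ≡ σ(h̄₂) (mod h)` (expressed via arbitrary representatives of the values). -/
def IsCongPres (f g : Polynomial F)
    (σ : (Polynomial F ⧸ Ideal.span {f}) → Polynomial F ⧸ Ideal.span {g}) : Prop :=
  ∀ h₁ h₂ h : Polynomial F, h₁.degree < f.degree → h₂.degree < f.degree →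
    h ∣ g → h ∣ h₁ - h₂ →
    ∀ s₁ s₂ : Polynomial F,
      Ideal.Quotient.mk (Ideal.span {g}) s₁ = σ (Ideal.Quotient.mk (Ideal.span {f}) h₁) →
      Ideal.Quotient.mk (Ideal.span {g}) s₂ = σ (Ideal.Quotient.mk (Ideal.span {f}) h₂) →
      h ∣ s₁ - s₂

/-- `σ : A_f → A_g` is a polynomial function: representable by some `G ∈ A[x]` on the
representatives of degree `< deg f`. -/
def IsPolyFun (f g : Polynomial F)
    (σ : (Polynomial F ⧸ Ideal.span {f}) → Polynomial F ⧸ Ideal.span {g}) : Prop :=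
  ∃ G : Polynomial (Polynomial F),
    ∀ h : Polynomial F, h.degree < f.degree →
      σ (Ideal.Quotient.mk (Ideal.span {f}) h) = Ideal.Quotient.mk (Ideal.span {g}) (G.eval h)

/-- `(f, g)` is a Chen pair: every congruence preserving function `A_f → A_g`
is a polynomial function. -/
def IsChenPair (f g : Polynomial F) : Prop :=
  ∀ σ : (Polynomial F ⧸ Ideal.span {f}) → Polynomial F ⧸ Ideal.span {g},
    IsCongPres f g σ → IsPolyFun f g σ

theorem exists_prod_eq_of_dvd_prod {M ι : Type*} [CommMonoid M] [DecompositionMonoid M]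
    (s : Finset ι) (a : ι → M) {h : M} (hd : h ∣ ∏ i ∈ s, a i) :
    ∃ b : ι → M, (∀ i ∈ s, b i ∣ a i) ∧ h ∣ ∏ i ∈ s, b i ∧ ∀ i ∈ s, b i ∣ h := by
  classical
  induction s using Finset.induction_on generalizing h with
  | empty => exact ⟨a, by simp, by simpa using hd, by simp⟩
  | insert i s his ih =>
    rw [Finset.prod_insert his] at hd
    obtain ⟨u, v, hu, hv, rfl⟩ := exists_dvd_and_dvd_of_dvd_mul hd
    obtain ⟨b, hb, hvb, hbv⟩ := ih hv
    have hne : ∀ j ∈ s, j ≠ i := fun j hj hji => his (hji ▸ hj)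
    refine ⟨Function.update b i u, ?_, ?_, ?_⟩
    · intro j hj
      rcases Finset.mem_insert.1 hj with rfl | hj
      · simpa using hu
      · simpa [hne j hj] using hb j hj
    · rw [Finset.prod_insert his, Finset.prod_congr rfl fun j hj =>
        Function.update_of_ne (hne j hj) u b]
      simpa using mul_dvd_mul_left u hvb
    · intro j hj
      rcases Finset.mem_insert.1 hj with rfl | hj
      · simp
      · simpa [hne j hj] using (hbv j hj).mul_left u

/-- Functions constant on the fibres of `ρ` correspond to functions on the range of `ρ`. -/
def factorsThroughEquiv {α β γ : Type*} (ρ : α → β) :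
    {τ : α → γ // τ.FactorsThrough ρ} ≃ (Set.range ρ → γ) where
  toFun τ y := τ.1 y.2.choose
  invFun φ := ⟨fun x => φ ⟨ρ x, x, rfl⟩, fun x y h => by simp only [h]⟩
  left_inv τ := Subtype.ext <| funext fun x => τ.2 (⟨x, rfl⟩ : ∃ y, ρ y = ρ x).choose_spec
  right_inv φ := funext fun y => congrArg φ (Subtype.ext y.2.choose_spec)

section Field

variable {K : Type*} [Field K]
variable {r : ℕ} {α : K} {P : Fin r → Polynomial K} {e : Fin r → ℕ} {f g : Polynomial K}

/-- The representative of degree less than `deg f` of a residue class modulo `f`. -/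
def reducedRep (f : Polynomial K) (x : Polynomial K ⧸ Ideal.span {f}) : Polynomial K :=
  Quotient.out x % f

theorem degree_reducedRep_lt {f : Polynomial K} (hf : f ≠ 0)
    (x : Polynomial K ⧸ Ideal.span {f}) : (reducedRep f x).degree < f.degree :=
  degree_mod_lt _ hf

theorem mk_reducedRep (f : Polynomial K) (x : Polynomial K ⧸ Ideal.span {f}) :
    Ideal.Quotient.mk (Ideal.span {f}) (reducedRep f x) = x := by
  conv_rhs => rw [← Ideal.Quotient.mk_out x]
  rw [Ideal.Quotient.mk_eq_mk_iff_sub_mem, Ideal.mem_span_singleton, reducedRep,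
    EuclideanDomain.mod_eq_sub_mul_div]
  exact ⟨-(Quotient.out x / f), by ring⟩

theorem reducedRep_mk {f h : Polynomial K} (hf : f ≠ 0) (hh : h.degree < f.degree) :
    reducedRep f (Ideal.Quotient.mk (Ideal.span {f}) h) = h := by
  have hd := mk_reducedRep f (Ideal.Quotient.mk (Ideal.span {f}) h)
  rw [Ideal.Quotient.mk_eq_mk_iff_sub_mem, Ideal.mem_span_singleton] at hd
  exact sub_eq_zero.1 <| eq_zero_of_dvd_of_degree_lt hd <|
    (degree_sub_le _ _).trans_lt (max_lt (degree_reducedRep_lt hf _) hh)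

/-- The reduction modulo `Q` of the representatives of degree less than `deg f`. -/
def reduction (f Q : Polynomial K) (x : Polynomial K ⧸ Ideal.span {f}) :
    Polynomial K ⧸ Ideal.span {Q} :=
  Ideal.Quotient.mk _ (reducedRep f x)

theorem reduction_eq_iff {f Q : Polynomial K} {x y : Polynomial K ⧸ Ideal.span {f}} :
    reduction f Q x = reduction f Q y ↔ Q ∣ reducedRep f x - reducedRep f y := by
  rw [reduction, reduction, Ideal.Quotient.mk_eq_mk_iff_sub_mem, Ideal.mem_span_singleton]

/-- The `j`-th digit, modulo `P`, of the `P`-adic expansion of `s`. -/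
def digit (P : Polynomial K) (j : ℕ) (s : Polynomial K) : Polynomial K ⧸ Ideal.span {P} :=
  Ideal.Quotient.mk _ (s /ₘ P ^ j)

theorem pow_dvd_sub_iff_digit {P : Polynomial K} (hP : P.Monic) (s t : Polynomial K) (k : ℕ) :
    P ^ k ∣ s - t ↔ ∀ j < k, digit P j s = digit P j t := by
  induction k with
  | zero => simp
  | succ k ih =>
    have key (h : P ^ k ∣ s - t) : s - t = P ^ k * (s /ₘ P ^ k - t /ₘ P ^ k) := by
      have h1 := modByMonic_add_div s (P ^ k)
      have h2 := modByMonic_add_div t (P ^ k)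
      have h3 := modByMonic_eq_of_dvd_sub (hP.pow k) h
      linear_combination h3 - h1 + h2
    have step : P ^ (k + 1) ∣ s - t ↔ P ^ k ∣ s - t ∧ digit P k s = digit P k t := by
      rw [digit, digit, Ideal.Quotient.mk_eq_mk_iff_sub_mem, Ideal.mem_span_singleton]
      constructor
      · intro h
        have hk := (pow_dvd_pow P k.le_succ).trans h
        rw [key hk, pow_succ] at h
        exact ⟨hk, (mul_dvd_mul_iff_left (hP.pow k).ne_zero).1 h⟩
      · rintro ⟨hk, h⟩
        rw [key hk, pow_succ]
        exact mul_dvd_mul_left _ h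
    rw [step, ih, Nat.forall_lt_succ_right]

theorem pairwise_isCoprime (hPmonic : ∀ i, (P i).Monic) (hPirr : ∀ i, Irreducible (P i))
    (hPdist : ∀ i j, i ≠ j → P i ≠ P j) {i j : Fin r} (hij : i ≠ j) :
    IsCoprime (P i) (P j) :=
  (hPirr i).coprime_iff_not_dvd.2 fun h => hPdist i j hij <|
    eq_of_monic_of_associated (hPmonic i) (hPmonic j) ((hPirr i).associated_of_dvd (hPirr j) h)

theorem dvd_of_forall_pow_dvd (hα : α ≠ 0) (hPmonic : ∀ i, (P i).Monic)
    (hPirr : ∀ i, Irreducible (P i)) (hPdist : ∀ i j, i ≠ j → P i ≠ P j)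
    (hg : g = C α * ∏ i, P i ^ e i) {h s : Polynomial K} (hh : h ∣ g)
    (H : ∀ i, ∀ k ≤ e i, P i ^ k ∣ h → P i ^ k ∣ s) : h ∣ s := by
  rw [hg, (isUnit_C.2 hα.isUnit).dvd_mul_left] at hh
  obtain ⟨b, hb, hhb, hbh⟩ := exists_prod_eq_of_dvd_prod _ _ hh
  choose k hk hbk using fun i => (dvd_prime_pow (hPirr i).prime _).1 (hb i (Finset.mem_univ i))
  refine hhb.trans <| Finset.prod_dvd_of_coprime (fun i _ j _ hij => ?_) fun i hi => ?_
  · exact ((pairwise_isCoprime hPmonic hPirr hPdist hij).pow.of_isCoprime_of_dvd_left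
      (hb i (Finset.mem_univ i))).of_isCoprime_of_dvd_right (hb j (Finset.mem_univ j))
  · exact (hbk i).dvd.trans (H i _ (hk i) ((hbk i).symm.dvd.trans (hbh i hi)))

theorem pow_dvd_of_factorization (hg : g = C α * ∏ i, P i ^ e i) {i : Fin r} {k : ℕ}
    (hk : k ≤ e i) : P i ^ k ∣ g :=
  hg ▸ ((pow_dvd_pow _ hk).trans
    (Finset.dvd_prod_of_mem (fun i => P i ^ e i) (Finset.mem_univ i))).mul_left _

theorem natDegree_of_factorization (hα : α ≠ 0) (hPmonic : ∀ i, (P i).Monic)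
    (hg : g = C α * ∏ i, P i ^ e i) : g.natDegree = ∑ i, e i * (P i).natDegree := by
  rw [hg, natDegree_C_mul hα, natDegree_prod_of_monic _ _ fun i _ => (hPmonic i).pow _]
  simp

/-- All the digits of a residue class modulo `g = α ∏ P i ^ e i`. -/
def digits (P : Fin r → Polynomial K) (e : Fin r → ℕ) (x : Polynomial K ⧸ Ideal.span {g})
    (p : Σ i, Fin (e i)) : Polynomial K ⧸ Ideal.span {P p.1} :=
  digit (P p.1) p.2 (Quotient.out x)

theorem isCongPres_iff_forall_reducedRep (hf : f ≠ 0)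
    {σ : (Polynomial K ⧸ Ideal.span {f}) → Polynomial K ⧸ Ideal.span {g}} :
    IsCongPres f g σ ↔ ∀ x y h, h ∣ g → h ∣ reducedRep f x - reducedRep f y →
      h ∣ Quotient.out (σ x) - Quotient.out (σ y) := by
  constructor
  · intro H x y h hg hxy
    refine H _ _ h (degree_reducedRep_lt hf x) (degree_reducedRep_lt hf y) hg hxy _ _ ?_ ?_
    · rw [Ideal.Quotient.mk_out, mk_reducedRep]
    · rw [Ideal.Quotient.mk_out, mk_reducedRep]
  · intro H h₁ h₂ h hh₁ hh₂ hg h12 s₁ s₂ hs₁ hs₂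
    have hσ := H (Ideal.Quotient.mk _ h₁) (Ideal.Quotient.mk _ h₂) h hg
      (by rwa [reducedRep_mk hf hh₁, reducedRep_mk hf hh₂])
    rw [← hs₁, ← hs₂] at hσ
    have hout (s : Polynomial K) :
        h ∣ Quotient.out (Ideal.Quotient.mk (Ideal.span {g}) s) - s :=
      hg.trans <| Ideal.mem_span_singleton.1 <|
        Ideal.Quotient.mk_eq_mk_iff_sub_mem _ _ |>.1 (Ideal.Quotient.mk_out _)
    convert (hσ.sub (hout s₁)).add (hout s₂) using 1
    ring

theorem isCongPres_iff_factorsThrough (hf : f ≠ 0) (hα : α ≠ 0) (hPmonic : ∀ i, (P i).Monic)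
    (hPirr : ∀ i, Irreducible (P i)) (hPdist : ∀ i j, i ≠ j → P i ≠ P j)
    (hg : g = C α * ∏ i, P i ^ e i)
    {σ : (Polynomial K ⧸ Ideal.span {f}) → Polynomial K ⧸ Ideal.span {g}} :
    IsCongPres f g σ ↔ ∀ p : Σ i, Fin (e i),
      (fun x => digits P e (σ x) p).FactorsThrough (reduction f (P p.1 ^ (p.2 + 1 : ℕ))) := by
  rw [isCongPres_iff_forall_reducedRep hf]
  constructor
  · rintro H ⟨i, j⟩ x y hxy
    exact (pow_dvd_sub_iff_digit (hPmonic i) _ _ (j + 1)).1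
      (H x y _ (pow_dvd_of_factorization hg j.2) (reduction_eq_iff.1 hxy)) j (Nat.lt_succ_self _)
  · intro H x y h hhg hxy
    refine dvd_of_forall_pow_dvd hα hPmonic hPirr hPdist hg hhg fun i k hk hkh => ?_
    refine (pow_dvd_sub_iff_digit (hPmonic i) _ _ k).2 fun j hj => ?_
    exact H ⟨i, j, hj.trans_le hk⟩ <|
      reduction_eq_iff.2 ((pow_dvd_pow _ hj).trans (hkh.trans hxy))

end Field

section Counting

variable {r : ℕ} {α : F} {P : Fin r → Polynomial F} {e : Fin r → ℕ} {f g : Polynomial F}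

theorem natCard_quotient_span {f : Polynomial F} (hf : f ≠ 0) :
    Nat.card (Polynomial F ⧸ Ideal.span {f}) = Fintype.card F ^ f.natDegree := by
  have : Module.Finite F (Polynomial F ⧸ Ideal.span {f}) :=
    (AdjoinRoot.powerBasis hf).finite
  rw [Module.natCard_eq_pow_finrank (K := F), finrank_quotient_span_eq_natDegree,
    Nat.card_eq_fintype_card]

theorem finite_quotient_span {f : Polynomial F} (hf : f ≠ 0) :
    Finite (Polynomial F ⧸ Ideal.span {f}) :=
  Nat.finite_of_card_ne_zero <| by
    rw [natCard_quotient_span hf]; exact pow_ne_zero _ Fintype.card_ne_zero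

theorem natCard_range_reduction {f Q : Polynomial F} (hf : f ≠ 0) (hQ : Q ≠ 0) :
    Nat.card (Set.range (reduction f Q)) =
      Fintype.card F ^ min f.natDegree Q.natDegree := by
  rcases le_total f.natDegree Q.natDegree with h | h
  · have hinj : Function.Injective (reduction f Q) := fun x y hxy => by
      have h0 : reducedRep f x = reducedRep f y :=
        sub_eq_zero.1 <| eq_zero_of_dvd_of_degree_lt (reduction_eq_iff.1 hxy) <|
          ((degree_sub_le _ _).trans_lt
            (max_lt (degree_reducedRep_lt hf _) (degree_reducedRep_lt hf _))).trans_le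
            (by rwa [degree_eq_natDegree hf, degree_eq_natDegree hQ, Nat.cast_le])
      rw [← mk_reducedRep f x, h0, mk_reducedRep]
    rw [min_eq_left h, ← natCard_quotient_span hf]
    exact (Nat.card_congr (Equiv.ofInjective _ hinj)).symm
  · have hsurj : Function.Surjective (reduction f Q) := fun y =>
      ⟨Ideal.Quotient.mk _ (reducedRep Q y), by
        rw [reduction, reducedRep_mk hf, mk_reducedRep]
        refine (degree_reducedRep_lt hQ y).trans_le ?_
        rwa [degree_eq_natDegree hQ, degree_eq_natDegree hf, Nat.cast_le]⟩
    rw [hsurj.range_eq, min_eq_right h, ← natCard_quotient_span hQ]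
    exact Nat.card_congr (Equiv.Set.univ _)

theorem digits_bijective (hg0 : g ≠ 0) (hα : α ≠ 0) (hPmonic : ∀ i, (P i).Monic)
    (hPirr : ∀ i, Irreducible (P i)) (hPdist : ∀ i j, i ≠ j → P i ≠ P j)
    (hg : g = C α * ∏ i, P i ^ e i) :
    Function.Bijective (digits (g := g) P e) := by
  have hfin (p : Σ i, Fin (e i)) : Finite (Polynomial F ⧸ Ideal.span {P p.1}) :=
    finite_quotient_span (hPmonic p.1).ne_zero
  refine (Nat.bijective_iff_injective_and_card _).2 ⟨fun x y hxy => ?_, ?_⟩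
  · rw [← Ideal.Quotient.mk_out x, ← Ideal.Quotient.mk_out y,
      Ideal.Quotient.mk_eq_mk_iff_sub_mem, Ideal.mem_span_singleton]
    refine dvd_of_forall_pow_dvd hα hPmonic hPirr hPdist hg dvd_rfl fun i k hk _ => ?_
    exact (pow_dvd_sub_iff_digit (hPmonic i) _ _ k).2 fun j hj =>
      congrFun hxy ⟨i, j, hj.trans_le hk⟩
  · rw [natCard_quotient_span hg0, Nat.card_pi, Fintype.prod_sigma,
      natDegree_of_factorization hα hPmonic hg, ← Finset.prod_pow_eq_pow_sum]
    refine Finset.prod_congr rfl fun i _ => ?_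
    simp [natCard_quotient_span (hPmonic i).ne_zero, ← pow_mul, mul_comm]

theorem natCard_isCongPres (hf : f ≠ 0) (hg0 : g ≠ 0) (hα : α ≠ 0)
    (hPmonic : ∀ i, (P i).Monic) (hPirr : ∀ i, Irreducible (P i))
    (hPdist : ∀ i j, i ≠ j → P i ≠ P j) (hg : g = C α * ∏ i, P i ^ e i) :
    Nat.card {σ : (Polynomial F ⧸ Ideal.span {f}) → Polynomial F ⧸ Ideal.span {g} //
        IsCongPres f g σ} =
      ∏ i, Fintype.card F ^ ((P i).natDegree *
        ∑ j ∈ Finset.range (e i),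
          Fintype.card F ^ min f.natDegree ((j + 1) * (P i).natDegree)) := by
  let D : (Polynomial F ⧸ Ideal.span {g}) ≃
      ((p : Σ i, Fin (e i)) → Polynomial F ⧸ Ideal.span {P p.1}) :=
    Equiv.ofBijective _ (digits_bijective hg0 hα hPmonic hPirr hPdist hg)
  let E : ((Polynomial F ⧸ Ideal.span {f}) → Polynomial F ⧸ Ideal.span {g}) ≃
      ((p : Σ i, Fin (e i)) → (Polynomial F ⧸ Ideal.span {f}) →
        Polynomial F ⧸ Ideal.span {P p.1}) :=
    (Equiv.piCongrRight fun _ => D).trans (Equiv.piComm _)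
  let T (p : Σ i, Fin (e i))
      (τ : (Polynomial F ⧸ Ideal.span {f}) → Polynomial F ⧸ Ideal.span {P p.1}) : Prop :=
    τ.FactorsThrough (reduction f (P p.1 ^ (p.2 + 1 : ℕ)))
  have hE (σ) : IsCongPres f g σ ↔ ∀ p, T p (E σ p) :=
    isCongPres_iff_factorsThrough hf hα hPmonic hPirr hPdist hg
  have : Finite (Polynomial F ⧸ Ideal.span {f}) := finite_quotient_span hf
  have hT (p) : Nat.card {τ // T p τ} = (Fintype.card F ^ (P p.1).natDegree) ^
      Fintype.card F ^ min f.natDegree ((p.2 + 1) * (P p.1).natDegree) := by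
    have hP0 := (hPmonic p.1).ne_zero
    rw [Nat.card_congr (factorsThroughEquiv _), Nat.card_fun, natCard_quotient_span hP0,
      natCard_range_reduction hf (pow_ne_zero _ hP0), natDegree_pow]
  rw [Nat.card_congr (E.subtypeEquiv (q := fun τ => ∀ p, T p (τ p)) hE),
    Nat.card_congr Equiv.subtypePiEquivPi, Nat.card_pi, Fintype.prod_sigma]
  refine Finset.prod_congr rfl fun i _ => ?_
  rw [Finset.prod_congr rfl fun j _ => hT ⟨i, j⟩, pow_mul, ← Finset.prod_pow_eq_pow_sum,
    Finset.prod_range]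

end Counting

theorem pow_min_add_sum_ite {q m : ℕ} (hq : 1 ≤ q) (hm : 1 ≤ m) (n : ℕ) :
    q ^ min n m + (q - 1) * ∑ k ∈ Finset.Ico 1 n, q ^ k * (if m ≤ k then 1 else 0) = q ^ n := by
  obtain ⟨q, rfl⟩ := Nat.exists_eq_add_of_le' hq
  rw [Nat.add_sub_cancel]
  induction n with
  | zero => simp
  | succ n ih =>
    rcases Nat.eq_zero_or_pos n with rfl | hn
    · simp [hm]
    rw [Finset.sum_Ico_succ_top hn]
    by_cases h : m ≤ n
    · rw [min_eq_right h] at ih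
      rw [min_eq_right (h.trans n.le_succ), if_pos h, pow_succ]
      linear_combination ih
    · have h0 : ∑ k ∈ Finset.Ico 1 n, (q + 1) ^ k * (if m ≤ k then 1 else 0) = 0 :=
        Finset.sum_eq_zero fun k hk => by
          rw [if_neg (by have := (Finset.mem_Ico.1 hk).2; omega), mul_zero]
      rw [h0, if_neg h, min_eq_left (by omega)]
      simp

theorem sum_pow_min_add_sum_min_div {q d : ℕ} (hq : 1 ≤ q) (hd : 1 ≤ d) (n e : ℕ) :
    ∑ j ∈ Finset.range e, q ^ min n ((j + 1) * d) +
      (q - 1) * ∑ k ∈ Finset.Ico 1 n, q ^ k * min e (k / d) = e * q ^ n := by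
  induction e with
  | zero => simp
  | succ e ih =>
    have hmin (k : ℕ) :
        min (e + 1) (k / d) = min e (k / d) + if (e + 1) * d ≤ k then 1 else 0 := by
      have := Nat.le_div_iff_mul_le hd (x := e + 1) (y := k)
      split_ifs <;> omega
    have h1 := pow_min_add_sum_ite hq (Nat.mul_pos e.succ_pos hd) n
    simp_rw [hmin, mul_add, Finset.sum_add_distrib]
    rw [Finset.sum_range_succ]
    linear_combination ih + h1

/-- Theorem: counting congruence preserving functions.
If `f, g` are non-constant, `g = α · P₁^{e₁} ⋯ P_r^{e_r}` is the prime factorization of `g`,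
and `n = deg f`, then the number `M(f,g)` of congruence preserving functions `A_f → A_g`
satisfies `M(f,g) · ∏_i |P_i|^{(q-1) Σ_{k=1}^{n-1} q^k min{e_i, ⌊k/d_i⌋}} = |g|^{q^n}`,
i.e. `M(f,g) = q^{q^n · deg g - Σ_i d_i (q-1) Σ_{k=1}^{n-1} q^k min{e_i, ⌊k/d_i⌋}}`. -/
theorem countCongPres (f g : Polynomial F) (hf : 1 ≤ f.natDegree) (hg' : 1 ≤ g.natDegree)
    (r : ℕ) (α : F) (hα : α ≠ 0) (P : Fin r → Polynomial F) (e : Fin r → ℕ)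
    (hPmonic : ∀ i, (P i).Monic) (hPirr : ∀ i, Irreducible (P i))
    (hPdist : ∀ i j, i ≠ j → P i ≠ P j) (he : ∀ i, 1 ≤ e i)
    (hg : g = Polynomial.C α * ∏ i, P i ^ e i) :
    Nat.card {σ : (Polynomial F ⧸ Ideal.span {f}) → Polynomial F ⧸ Ideal.span {g} //
        IsCongPres f g σ} *
      ∏ i, (Fintype.card F) ^ ((P i).natDegree *
        ((Fintype.card F - 1) * ∑ k ∈ Finset.Ico 1 f.natDegree,
          (Fintype.card F) ^ k * min (e i) (k / (P i).natDegree)))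
    = (Fintype.card F) ^ (g.natDegree * (Fintype.card F) ^ f.natDegree) := by
  have hf0 : f ≠ 0 := ne_zero_of_natDegree_gt hf
  have hg0 : g ≠ 0 := ne_zero_of_natDegree_gt hg'
  rw [natCard_isCongPres hf0 hg0 hα hPmonic hPirr hPdist hg, ← Finset.prod_mul_distrib,
    natDegree_of_factorization hα hPmonic hg, Finset.sum_mul, ← Finset.prod_pow_eq_pow_sum]
  refine Finset.prod_congr rfl fun i _ => ?_
  rw [← pow_add, ← mul_add, sum_pow_min_add_sum_min_div Fintype.card_pos
    (hPirr i).natDegree_pos]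
  congr 1
  ring
end
end

section
/- Let f, g ∈ A be non-constant polynomials, and let g have prime factorization g = α P₁^{e₁} ⋯ P_r^{e_r} with α ∈ F_q*, each P_i monic irreducible and each e_i ≥ 1. Then every function σ : A_f → A_g is congruence preserving if and only if deg f ≤ deg P_i for all 1 ≤ i ≤ r. -/
open Polynomial

noncomputable section

variable {F : Type*} [Field F] [Fintype F]

/-- every function `σ : A_f → A_g` is congruence preserving
iff `deg f ≤ deg P_i` for all `i`, where `g = α · P₁^{e₁} ⋯ P_r^{e_r}`. -/
theorem allCongPres_iff (f g : Polynomial F) (hf : 1 ≤ f.natDegree) (hg' : 1 ≤ g.natDegree)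
    (r : ℕ) (α : F) (hα : α ≠ 0) (P : Fin r → Polynomial F) (e : Fin r → ℕ)
    (hPmonic : ∀ i, (P i).Monic) (hPirr : ∀ i, Irreducible (P i))
    (hPdist : ∀ i j, i ≠ j → P i ≠ P j) (he : ∀ i, 1 ≤ e i)
    (hg : g = Polynomial.C α * ∏ i, P i ^ e i) :
    (∀ σ : (Polynomial F ⧸ Ideal.span {f}) → Polynomial F ⧸ Ideal.span {g},
        IsCongPres f g σ) ↔
      ∀ i, f.natDegree ≤ (P i).natDegree := by
  have hg0 : g ≠ 0 := ne_zero_of_natDegree_gt hg'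
  have hf0 : f ≠ 0 := ne_zero_of_natDegree_gt hf
  constructor
  · intro hall i
    by_contra! hlt
    have hPf : (P i).degree < f.degree := degree_lt_degree hlt
    have hPg : P i ∣ g := hg ▸ ((dvd_pow_self _ (Nat.one_le_iff_ne_zero.mp (he i))).trans
      (Finset.dvd_prod_of_mem (fun j => P j ^ e j) (Finset.mem_univ i))).mul_left _
    have hne : Ideal.Quotient.mk (Ideal.span {f}) (P i) ≠
        Ideal.Quotient.mk (Ideal.span {f}) 0 := by
      rw [map_zero, Ne, Ideal.Quotient.eq_zero_iff_dvd]
      exact not_dvd_of_degree_lt (hPirr i).ne_zero hPf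
    classical
    have hdvd := hall
      (fun x => if x = Ideal.Quotient.mk (Ideal.span {f}) 0 then 0 else 1)
      (P i) 0 (P i) hPf (by simpa [bot_lt_iff_ne_bot] using hf0) hPg (by simp) 1 0
      (by simp only [if_neg hne, map_one]) (by simp)
    rw [sub_zero] at hdvd
    exact (hPirr i).not_isUnit (isUnit_of_dvd_one hdvd)
  · intro hdeg σ h₁ h₂ h hh₁ hh₂ hhg hh s₁ s₂ hs₁ hs₂
    by_cases hu : IsUnit h
    · exact hu.dvd
    obtain ⟨p, hp, hph⟩ := WfDvdMonoid.exists_irreducible_factor hu (ne_zero_of_dvd_ne_zero hg0 hhg)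
    have hpg : p ∣ C α * ∏ i, P i ^ e i := hg ▸ hph.trans hhg
    rw [(isUnit_C.mpr hα.isUnit).dvd_mul_left, hp.prime.dvd_finsetProd_iff] at hpg
    obtain ⟨i, -, hi⟩ := hpg
    have hPp : P i ∣ p := (hp.associated_of_dvd (hPirr i) (hp.prime.dvd_of_dvd_pow hi)).symm.dvd
    have heq : h₁ - h₂ = 0 := eq_zero_of_dvd_of_degree_lt (hPp.trans (hph.trans hh))
      (((degree_sub_le _ _).trans_lt (max_lt hh₁ hh₂)).trans_le
        (by simpa [degree_eq_natDegree hf0, degree_eq_natDegree (hPirr i).ne_zero] using hdeg i))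
    rw [← sub_eq_zero.mp heq, ← hs₁, Ideal.Quotient.mk_eq_mk_iff_sub_mem,
      Ideal.mem_span_singleton, dvd_sub_comm] at hs₂
    exact hhg.trans hs₂
end
end

section
/- Let f, g ∈ A be non-constant polynomials. Then (f, g) is a Chen pair if and only if deg f < γ(g). -/
open Polynomial

noncomputable section

variable {F : Type*} [Field F] [Fintype F]

/-- The function `γ` on prime powers `P^e` (`q` is the size of the base field):
if `q = 2`: `γ(P^e) = ∞` if `e = 1`, or if `e = 2` and `deg P = 1`, and `deg P + 2` otherwise;
if `q > 2`: `γ(P^e) = ∞` if `e = 1`, and `deg P + 1` otherwise. -/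
def gammaPow (q : ℕ) (P : Polynomial F) (e : ℕ) : ℕ∞ :=
  if e = 1 then ⊤
  else if q = 2 then (if e = 2 ∧ P.natDegree = 1 then ⊤ else ((P.natDegree + 2 : ℕ) : ℕ∞))
  else ((P.natDegree + 1 : ℕ) : ℕ∞)

/-- Every function on polynomials of degree `< n` that preserves congruences modulo the divisors
of `g` agrees modulo `g` with a polynomial. -/
def IsChenModulus {F : Type*} [Field F] (n : ℕ) (g : F[X]) : Prop :=
  ∀ s : F[X] → F[X],
    (∀ a b h : F[X], a.degree < n → b.degree < n → h ∣ g → h ∣ a - b → h ∣ s a - s b) →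
    ∃ G : F[X][X], ∀ a : F[X], a.degree < n → g ∣ G.eval a - s a

section ChenModulus

variable {F : Type*} [Field F]

theorem isChenPair_iff_isChenModulus (f g : F[X]) (hf : f ≠ 0) :
    IsChenPair f g ↔ IsChenModulus f.natDegree g := by
  have hmk (a b : F[X]) : Ideal.Quotient.mk (Ideal.span {g}) a = Ideal.Quotient.mk _ b ↔
      g ∣ a - b := by
    rw [Ideal.Quotient.eq, Ideal.mem_span_singleton]
  unfold IsChenPair IsChenModulus IsCongPres IsPolyFun
  rw [← degree_eq_natDegree hf]
  constructor
  · intro H s hs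
    let r : F[X] ⧸ Ideal.span {f} → F[X] := fun x => Quotient.out x % f
    have hr (a : F[X]) (ha : a.degree < f.degree) : r (Ideal.Quotient.mk _ a) = a := by
      have h1 : f ∣ Quotient.out (Ideal.Quotient.mk (Ideal.span {f}) a) - a := by
        rw [← Ideal.mem_span_singleton, ← Ideal.Quotient.eq]
        exact Quotient.out_eq _
      have h2 := (EuclideanDomain.mod_eq_zero).2 h1
      change Quotient.out (Ideal.Quotient.mk (Ideal.span {f}) a) % f = a
      rw [sub_mod, sub_eq_zero] at h2
      rw [h2, (mod_eq_self_iff hf).2 ha]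
    obtain ⟨G, hG⟩ := H (fun x => Ideal.Quotient.mk _ (s (r x))) (by
      intro a b h ha hb hg hab s₁ s₂ h₁ h₂
      rw [hr a ha, hmk] at h₁
      rw [hr b hb, hmk] at h₂
      have := dvd_sub (dvd_add (hg.trans h₁) (hs a b h ha hb hg hab)) (hg.trans h₂)
      convert this using 1
      ring)
    refine ⟨G, fun a ha => ?_⟩
    have := hG a ha
    rw [hr a ha] at this
    exact (hmk _ _).1 this.symm
  · intro H σ hσ
    obtain ⟨G, hG⟩ := H (fun a => Quotient.out (σ (Ideal.Quotient.mk _ a)))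
      (fun a b h ha hb hg hab => hσ a b h ha hb hg hab _ _ (Quotient.out_eq _) (Quotient.out_eq _))
    refine ⟨G, fun a ha => ?_⟩
    rw [(hmk _ _).2 (hG a ha)]
    exact (Quotient.out_eq _).symm

theorem isChenModulus_of_isUnit (n : ℕ) {g : F[X]} (hg : IsUnit g) : IsChenModulus n g :=
  fun _ _ => ⟨0, fun _ _ => hg.dvd⟩

theorem IsChenModulus.of_mul_left {n : ℕ} {g₁ g₂ : F[X]} (hc : IsCoprime g₁ g₂)
    (H : IsChenModulus n (g₁ * g₂)) : IsChenModulus n g₁ := by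
  intro s hs
  obtain ⟨G, hG⟩ := H (fun a => g₂ * s a) (by
    intro a b h ha hb hg hab
    obtain ⟨h₁, h₂, hh₁, hh₂, rfl⟩ := exists_dvd_and_dvd_of_dvd_mul hg
    rw [← mul_sub, mul_comm]
    exact mul_dvd_mul hh₂ (hs a b h₁ ha hb hh₁ ((dvd_mul_right _ _).trans hab)))
  obtain ⟨u, v, huv⟩ := hc
  refine ⟨C v * G, fun a ha => ?_⟩
  obtain ⟨c, hc⟩ := hG a ha
  refine ⟨v * g₂ * c - u * s a, ?_⟩
  simp only [eval_mul, eval_C]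
  linear_combination v * hc + s a * huv

theorem isChenModulus_mul {n : ℕ} {g₁ g₂ : F[X]} (hc : IsCoprime g₁ g₂) :
    IsChenModulus n (g₁ * g₂) ↔ IsChenModulus n g₁ ∧ IsChenModulus n g₂ := by
  refine ⟨fun H => ⟨H.of_mul_left hc, (mul_comm g₁ g₂ ▸ H).of_mul_left hc.symm⟩, ?_⟩
  rintro ⟨H₁, H₂⟩ s hs
  obtain ⟨G₁, hG₁⟩ := H₁ s fun a b h ha hb hg => hs a b h ha hb (hg.mul_right _)
  obtain ⟨G₂, hG₂⟩ := H₂ s fun a b h ha hb hg => hs a b h ha hb (hg.mul_left _)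
  obtain ⟨u, v, huv⟩ := hc
  refine ⟨C (v * g₂) * G₁ + C (u * g₁) * G₂, fun a ha => ?_⟩
  obtain ⟨c, hc⟩ := hG₁ a ha
  obtain ⟨d, hd⟩ := hG₂ a ha
  refine ⟨v * c + u * d, ?_⟩
  simp only [eval_mul, eval_C, eval_add]
  linear_combination v * g₂ * hc + u * g₁ * hd + s a * huv

theorem isChenModulus_prod {n : ℕ} {ι : Type*} (T : Finset ι) (g : ι → F[X])
    (hc : Pairwise fun i j => IsCoprime (g i) (g j)) :
    IsChenModulus n (∏ i ∈ T, g i) ↔ ∀ i ∈ T, IsChenModulus n (g i) := by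
  classical
  induction T using Finset.induction_on with
  | empty => simpa using isChenModulus_of_isUnit n isUnit_one
  | insert i T hi ih =>
    rw [Finset.prod_insert hi, isChenModulus_mul, ih, Finset.forall_mem_insert]
    exact IsCoprime.prod_right fun j hj => hc (ne_of_mem_of_not_mem hj hi).symm

/-- Newton interpolation modulo a prime power, on a set in which two distinct elements can only
be congruent modulo `P` if they differ by `P` itself. -/
theorem exists_eval_congr_of_sub_eq {P : F[X]} (hP : Irreducible P) (e : ℕ) (T : Finset F[X])
    (hT : ∀ x ∈ T, ∀ y ∈ T, x ≠ y → P ∣ x - y → y = x + P) (s : F[X] → F[X])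
    (hs : ∀ x ∈ T, ∀ y ∈ T, P ∣ x - y → P ∣ s x - s y) :
    ∃ G : F[X][X], ∀ x ∈ T, P ^ e ∣ G.eval x - s x := by
  classical
  induction T using Finset.induction_on with
  | empty => exact ⟨0, by simp⟩
  | insert x T hx ih =>
    obtain ⟨G, hG⟩ := ih (fun a ha b hb => hT a (by simp [ha]) b (by simp [hb]))
      (fun a ha b hb => hs a (by simp [ha]) b (by simp [hb]))
    have hcop (U : Finset F[X]) (hU : U ⊆ T) (hU' : x + P ∉ U) :
        IsCoprime (∏ y ∈ U, (x - y)) (P ^ e) := by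
      refine IsCoprime.prod_left fun y hy => IsCoprime.pow_right ?_
      refine (hP.coprime_iff_not_dvd.2 fun hd => hU' ?_).symm
      rw [← hT x (by simp) y (by simp [hU hy]) (ne_of_mem_of_not_mem (hU hy) hx).symm hd]
      exact hy
    have key : ∃ c, P ^ e ∣ (∏ y ∈ T, (x - y)) * c - (s x - G.eval x) := by
      by_cases hxP : x + P ∈ T
      · rcases Nat.eq_zero_or_pos e with rfl | he
        · exact ⟨0, by simp⟩
        have hPr : P ∣ s x - G.eval x := by
          have h1 : P ∣ s x - s (x + P) := hs x (by simp) _ (by simp [hxP]) (by simp)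
          have h2 : P ∣ G.eval (x + P) - s (x + P) :=
            (dvd_pow_self P he.ne').trans (hG _ hxP)
          have h3 : P ∣ G.eval (x + P) - G.eval x := by
            simpa using G.sub_dvd_eval_sub (x + P) x
          convert (h1.sub h2).add h3 using 1
          ring
        obtain ⟨r, hr⟩ := hPr
        obtain ⟨u, v, huv⟩ := hcop (T.erase (x + P)) (T.erase_subset _) (by simp)
        refine ⟨-u * r, -P * v * r, ?_⟩
        rw [← Finset.mul_prod_erase T _ hxP, hr]
        linear_combination P * r * huv
      · obtain ⟨u, v, huv⟩ := hcop T subset_rfl hxP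
        refine ⟨u * (s x - G.eval x), -v * (s x - G.eval x), ?_⟩
        linear_combination (s x - G.eval x) * huv
    obtain ⟨c, hc⟩ := key
    refine ⟨G + C c * ∏ y ∈ T, (X - C y), Finset.forall_mem_insert .. |>.2 ⟨?_, fun y hy => ?_⟩⟩
    · simp only [eval_add, eval_mul, eval_C, eval_prod, eval_sub, eval_X]
      convert hc using 1
      ring
    · simpa [eval_prod, Finset.prod_eq_zero hy (sub_self y)] using hG y hy

theorem isChenModulus_pow_of_min_le [Fintype F] {P : F[X]} (hP : Irreducible P) (hm : P.Monic)
    {n e : ℕ} (he : 1 ≤ e)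
    (h : min n (P.natDegree * e) ≤ P.natDegree ∨
      Fintype.card F = 2 ∧ min n (P.natDegree * e) ≤ P.natDegree + 1) :
    IsChenModulus n (P ^ e) := by
  intro s hs
  set m := min n (P.natDegree * e) with hmdef
  have hfin : {a : F[X] | a.degree < m}.Finite := by
    have : Finite (degreeLT F m) := Finite.of_equiv _ (degreeLTEquiv F m).toEquiv.symm
    refine (Set.toFinite (degreeLT F m : Set F[X])).subset fun a ha => ?_
    exact mem_degreeLT.2 ha
  have hmn : ((m : ℕ) : WithBot ℕ) ≤ n := by exact_mod_cast min_le_left _ _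
  have hPe : (P ^ e).degree = ((P.natDegree * e : ℕ) : WithBot ℕ) := by
    rw [degree_eq_natDegree (pow_ne_zero _ hP.ne_zero), natDegree_pow, mul_comm]
  obtain ⟨G, hG⟩ := exists_eval_congr_of_sub_eq hP e hfin.toFinset (by
    intro x hx y hy hxy hd
    rw [Set.Finite.mem_toFinset] at hx hy
    have hdeg : (x - y).degree < m := (degree_sub_le _ _).trans_lt (max_lt hx hy)
    have hne : x - y ≠ 0 := sub_ne_zero.2 hxy
    rw [degree_eq_natDegree hne, Nat.cast_lt] at hdeg
    have hle := natDegree_le_of_dvd hd hne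
    rcases h with h | ⟨hq, h⟩
    · omega
    obtain ⟨c, hc⟩ := hd
    have hc0 : c ≠ 0 := by rintro rfl; simp_all
    have hcd : c.natDegree = 0 := by
      have := natDegree_mul hP.ne_zero hc0
      rw [← hc] at this
      omega
    obtain ⟨k, rfl⟩ := natDegree_eq_zero.1 hcd
    have hk0 : k ≠ 0 := by rintro rfl; simp at hc0
    have hpow := FiniteField.pow_card_sub_one_eq_one k hk0
    rw [hq] at hpow
    have hk1 : k = 1 := by simpa using hpow
    have h2 : (2 : F) = 0 := by
      have := FiniteField.cast_card_eq_zero F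
      rw [hq] at this
      exact_mod_cast this
    have h2' : (2 : F[X]) = 0 := by
      rw [← C_ofNat, h2, C_0]
    rw [hk1, C_1, mul_one] at hc
    linear_combination -hc - P * h2') s (by
    intro x hx y hy hd
    rw [Set.Finite.mem_toFinset] at hx hy
    exact hs x y P (hx.trans_le hmn) (hy.trans_le hmn) (dvd_pow_self P (by omega)) hd)
  refine ⟨G, fun a ha => ?_⟩
  have hb1 : (a % P ^ e).degree < n := by
    rw [← modByMonic_eq_mod _ (hm.pow e)]
    exact (degree_modByMonic_le_left).trans_lt ha
  have hb2 : (a % P ^ e).degree < ((P.natDegree * e : ℕ) : WithBot ℕ) := by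
    rw [← hPe]
    exact degree_mod_lt _ (pow_ne_zero _ hP.ne_zero)
  have hb : (a % P ^ e).degree < (m : WithBot ℕ) := by
    rcases min_choice n (P.natDegree * e) with h' | h' <;> rw [hmdef, h'] <;> assumption
  have hab : P ^ e ∣ a - a % P ^ e :=
    ⟨a / P ^ e, by linear_combination -EuclideanDomain.div_add_mod a (P ^ e)⟩
  have h1 := hG _ (by simpa using hb)
  have h2 := hs a _ _ ha hb1 dvd_rfl hab
  have h3 := hab.trans (G.sub_dvd_eval_sub a (a % P ^ e))
  convert (h1.sub h2).add h3 using 1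
  ring

/-- The function sending the class of `b` modulo `P ^ (k + 1)` to `P ^ k` and everything else
to `0` preserves congruences modulo every power of `P`. -/
theorem dvd_ite_sub_ite {P : F[X]} (hP : Irreducible P)
    [DecidableRel ((· ∣ ·) : F[X] → F[X] → Prop)]
    (k e : ℕ) (b x y h : F[X]) (hh : h ∣ P ^ e) (hxy : h ∣ x - y) :
    h ∣ (if P ^ (k + 1) ∣ x - b then P ^ k else 0) -
      (if P ^ (k + 1) ∣ y - b then P ^ k else 0) := by
  obtain ⟨i, -, hi⟩ := (dvd_prime_pow hP.prime e).1 hh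
  rw [hi.dvd_iff_dvd_left] at hxy ⊢
  rcases le_or_gt i k with hik | hik
  · have := pow_dvd_pow P hik
    split_ifs <;> simp [this]
  · have : P ^ (k + 1) ∣ x - b ↔ P ^ (k + 1) ∣ y - b := by
      have h1 := (pow_dvd_pow P hik).trans hxy
      rw [show x - b = (y - b) + (x - y) by ring]
      exact (dvd_add_left h1)
    simp [this]

theorem not_isChenModulus_pow_of_not_dvd {P c : F[X]} (hP : Irreducible P) {n e : ℕ} (he : 2 ≤ e)
    (hn : P.natDegree < n) (hcn : (c * P).degree < n) (hc : ¬ P ∣ c) (hc1 : ¬ P ∣ c - 1) :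
    ¬ IsChenModulus n (P ^ e) := by
  classical
  intro H
  obtain ⟨G, hG⟩ := H (fun x => if P ^ (1 + 1) ∣ x - c * P then P ^ 1 else 0)
    (fun a b h _ _ hh hab => dvd_ite_sub_ite hP 1 e _ a b h hh hab)
  have hP2 (x : F[X]) : P ^ (1 + 1) ∣ x * P ↔ P ∣ x := by
    rw [one_add_one_eq_two, sq, mul_dvd_mul_iff_right hP.ne_zero]
  have hpe : P ^ (1 + 1) ∣ P ^ e := pow_dvd_pow P he
  have h0 := hpe.trans (hG 0 (by simp))
  have h1 := hpe.trans (hG P (by rw [degree_eq_natDegree hP.ne_zero]; exact_mod_cast hn))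
  have h2 := hpe.trans (hG _ hcn)
  rw [show 0 - c * P = (-c) * P by ring, hP2, dvd_neg, if_neg hc] at h0
  rw [show P - c * P = (-(c - 1)) * P by ring, hP2, dvd_neg, if_neg hc1] at h1
  simp only [sub_self, dvd_zero, if_true, sub_zero] at h0 h1 h2
  have htaylor (z : F[X]) :
      P ^ (1 + 1) ∣ G.eval (z * P) - G.eval 0 - G.derivative.eval 0 * (z * P) := by
    obtain ⟨w, hw⟩ := G.binomExpansion 0 (z * P)
    exact ⟨w * z ^ 2, by rw [zero_add] at hw; linear_combination hw⟩
  have h3 := htaylor 1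
  have h4 := htaylor c
  rw [one_mul] at h3
  have h5 : P ^ (1 + 1) ∣ G.derivative.eval 0 * P := by
    convert (h1.sub h0).sub h3 using 1
    ring
  have h6 : P ^ (1 + 1) ∣ 1 * P := by
    convert ((h2.sub h0).sub h4).sub (h5.mul_left c) |>.neg_right using 1
    ring
  rw [hP2] at h6
  exact hP.not_isUnit (isUnit_of_dvd_one h6)

theorem not_isChenModulus_pow_of_two_eq_zero {P : F[X]} (hP : Irreducible P)
    (h2 : (2 : F) = 0) {n e : ℕ} (he : 3 ≤ e) (hn : P.natDegree * 2 < n) :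
    ¬ IsChenModulus n (P ^ e) := by
  classical
  intro H
  obtain ⟨G, hG⟩ := H (fun x => if P ^ (2 + 1) ∣ x - P ^ 2 then P ^ 2 else 0)
    (fun a b h _ _ hh hab => dvd_ite_sub_ite hP 2 e _ a b h hh hab)
  have h2' : (2 : F[X]) = 0 := by
    rw [← C_ofNat, h2, C_0]
  have hpe : P ^ (2 + 1) ∣ P ^ e := pow_dvd_pow P he
  have hdP : P.degree < n := by
    rw [degree_eq_natDegree hP.ne_zero, Nat.cast_lt]
    omega
  have hdP2 : (P ^ 2).degree < n := by
    rw [degree_eq_natDegree (pow_ne_zero _ hP.ne_zero), natDegree_pow, Nat.cast_lt]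
    omega
  have hnot (x : F[X]) (hx : ¬ P ∣ x) (k : ℕ) (hk : k ≤ 2) : ¬ P ^ (2 + 1) ∣ x * P ^ k := by
    intro h
    have h' : P * P ^ k ∣ x * P ^ k := by
      rw [← pow_succ']
      exact (pow_dvd_pow P (by omega)).trans h
    exact hx ((mul_dvd_mul_iff_right (pow_ne_zero _ hP.ne_zero)).1 h')
  have hP1 : ¬ P ∣ 1 := fun h => hP.not_isUnit (isUnit_of_dvd_one h)
  have hP1' : ¬ P ∣ 1 - P := fun h => hP1 (by simpa using h.add (dvd_refl P))
  have h0 := hpe.trans (hG 0 (by simp))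
  have h1 := hpe.trans (hG P hdP)
  have h3 := hpe.trans (hG (P ^ 2) hdP2)
  have h4 := hpe.trans (hG (P + P ^ 2) ((degree_add_le _ _).trans_lt (max_lt hdP hdP2)))
  rw [if_neg (by simpa using hnot 1 hP1 2 le_rfl)] at h0
  rw [if_neg (by
    rw [show P - P ^ 2 = (1 - P) * P ^ 1 by ring]
    exact hnot _ hP1' 1 (by omega))] at h1
  rw [if_pos (by simp)] at h3
  rw [if_neg (by simpa using hnot 1 hP1 1 (by omega))] at h4
  have hexp (z : F[X]) : ∃ w, G.eval (z * P) = G.coeff 0 + G.coeff 1 * (z * P) +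
      G.coeff 2 * (z * P) ^ 2 + P ^ (2 + 1) * w := by
    refine ⟨z ^ 3 * G.divX.divX.divX.eval (z * P), ?_⟩
    conv_lhs => rw [← G.divX_mul_X_add, ← G.divX.divX_mul_X_add, ← G.divX.divX.divX_mul_X_add]
    simp only [eval_add, eval_mul, eval_X, eval_C, coeff_divX]
    ring
  obtain ⟨w₀, hw₀⟩ := hexp 0
  obtain ⟨w₁, hw₁⟩ := hexp 1
  obtain ⟨w₂, hw₂⟩ := hexp P
  obtain ⟨w₃, hw₃⟩ := hexp (1 + P)
  rw [zero_mul] at hw₀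
  rw [one_mul] at hw₁
  rw [← sq] at hw₂
  rw [show (1 + P) * P = P + P ^ 2 by ring] at hw₃
  refine hnot 1 hP1 2 le_rfl ?_
  obtain ⟨v₀, hv₀⟩ := h0
  obtain ⟨v₁, hv₁⟩ := h1
  obtain ⟨v₂, hv₂⟩ := h3
  obtain ⟨v₃, hv₃⟩ := h4
  refine ⟨w₀ + w₁ + w₂ + w₃ - v₀ - v₁ - v₂ - v₃, ?_⟩
  linear_combination hw₀ + hw₁ + hw₂ + hw₃ - hv₀ - hv₁ - hv₂ - hv₃ +
    (2 * G.coeff 0 + G.coeff 1 * (P + P ^ 2) + G.coeff 2 * (P ^ 2 + P ^ 3 + P ^ 4)) * h2'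

theorem isChenModulus_pow_iff [Fintype F] {P : F[X]} (hP : Irreducible P) (hm : P.Monic)
    {n e : ℕ} (he : 1 ≤ e) :
    IsChenModulus n (P ^ e) ↔ min n (P.natDegree * e) ≤ P.natDegree ∨
      Fintype.card F = 2 ∧ min n (P.natDegree * e) ≤ P.natDegree + 1 := by
  classical
  refine ⟨fun H => ?_, isChenModulus_pow_of_min_le hP hm he⟩
  by_contra! ⟨h1, h2⟩
  have hd : 0 < P.natDegree := hP.natDegree_pos
  have he2 : 2 ≤ e := by
    by_contra he'
    obtain rfl : e = 1 := by omega
    simp at h1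
  have hn : P.natDegree < n := h1.trans_le (min_le_left _ _)
  have hdvd (c : F[X]) (hc0 : c ≠ 0) (hc : c.natDegree < P.natDegree) : ¬ P ∣ c := fun h =>
    hc.not_ge (natDegree_le_of_dvd h hc0)
  by_cases hq : Fintype.card F = 2
  · have hm2 := h2 hq
    have hn2 : P.natDegree + 1 < n := hm2.trans_le (min_le_left _ _)
    have hde : P.natDegree + 1 < P.natDegree * e := hm2.trans_le (min_le_right _ _)
    rcases Nat.lt_or_ge 1 P.natDegree with hd1 | hd1
    · refine not_isChenModulus_pow_of_not_dvd (c := X) hP he2 hn ?_ ?_ ?_ H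
      · rw [degree_eq_natDegree (mul_ne_zero X_ne_zero hP.ne_zero),
          natDegree_X_mul hP.ne_zero]
        exact_mod_cast hn2
      · exact hdvd X X_ne_zero (by simpa using hd1)
      · have := X_sub_C_ne_zero (1 : F)
        have h' := natDegree_X_sub_C (1 : F)
        rw [C_1] at this h'
        exact hdvd _ this (by omega)
    · have hd1 : P.natDegree = 1 := by omega
      rw [hd1] at hde hn2
      refine not_isChenModulus_pow_of_two_eq_zero hP ?_ (by omega) (by omega) H
      have := FiniteField.cast_card_eq_zero F
      rw [hq] at this
      exact_mod_cast this
  · have hcard : 2 < Fintype.card F := by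
      have := Fintype.one_lt_card (α := F)
      omega
    obtain ⟨k, hk⟩ : ∃ k : F, k ∉ ({0, 1} : Finset F) := by
      by_contra! hall
      have := Finset.card_le_card (s := Finset.univ) (fun k _ => hall k)
      rw [Finset.card_univ] at this
      have := this.trans (Finset.card_le_two)
      omega
    simp only [Finset.mem_insert, Finset.mem_singleton, not_or] at hk
    refine not_isChenModulus_pow_of_not_dvd (c := C k) hP he2 hn ?_ ?_ ?_ H
    · rw [degree_C_mul hk.1, degree_eq_natDegree hP.ne_zero]
      exact_mod_cast hn
    · exact hdvd _ (by simpa using hk.1) (by simpa using hd)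
    · rw [← C_1, ← C_sub]
      exact hdvd _ (C_ne_zero.2 (sub_ne_zero.2 hk.2)) (by simpa only [natDegree_C] using hd)

theorem natCast_lt_gammaPow_iff {P : F[X]} (hP : 0 < P.natDegree) {n q e : ℕ} (he : 1 ≤ e) :
    (n : ℕ∞) < gammaPow q P e ↔ min n (P.natDegree * e) ≤ P.natDegree ∨
      q = 2 ∧ min n (P.natDegree * e) ≤ P.natDegree + 1 := by
  unfold gammaPow
  rcases Nat.lt_or_ge 1 e with h1 | h1
  · have h2 : 2 * P.natDegree ≤ P.natDegree * e := by nlinarith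
    have h3 : P.natDegree * e ≤ P.natDegree + 1 ↔ e = 2 ∧ P.natDegree = 1 := by
      constructor
      · intro h
        have hd : P.natDegree = 1 := by omega
        rw [hd] at h
        exact ⟨by omega, hd⟩
      · rintro ⟨rfl, h⟩
        rw [h]
    split_ifs with h4 h5 h6
    · omega
    · simp [h5, h3.2 h6]
    · rw [Nat.cast_lt]
      omega
    · rw [Nat.cast_lt]
      omega
  · obtain rfl : e = 1 := by omega
    simp

end ChenModulus

/-- Theorem: determination of Chen pairs.
For non-constant `f, g` with prime factorization `g = α · P₁^{e₁} ⋯ P_r^{e_r}`,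
the pair `(f,g)` is a Chen pair iff `deg f < γ(g) = min_i γ(P_i^{e_i})`. -/
theorem chenPair_iff_lt_gamma (f g : Polynomial F) (hf : 1 ≤ f.natDegree)
    (hg' : 1 ≤ g.natDegree)
    (r : ℕ) (α : F) (hα : α ≠ 0) (P : Fin r → Polynomial F) (e : Fin r → ℕ)
    (hPmonic : ∀ i, (P i).Monic) (hPirr : ∀ i, Irreducible (P i))
    (hPdist : ∀ i j, i ≠ j → P i ≠ P j) (he : ∀ i, 1 ≤ e i)
    (hg : g = Polynomial.C α * ∏ i, P i ^ e i) :
    IsChenPair f g ↔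
      (f.natDegree : ℕ∞) < Finset.univ.inf fun i => gammaPow (Fintype.card F) (P i) (e i) := by
  have hcop : Pairwise fun i j => IsCoprime (P i ^ e i) (P j ^ e j) := fun i j hij =>
    IsCoprime.pow <| (hPirr i).coprime_iff_not_dvd.2 fun h => hPdist i j hij <|
      eq_of_monic_of_associated (hPmonic i) (hPmonic j) ((hPirr i).associated_of_dvd (hPirr j) h)
  have hu : IsUnit (C α) := isUnit_C.2 hα.isUnit
  have hcα : IsCoprime (C α) (∏ i, P i ^ e i) :=
    ⟨C α⁻¹, 0, by rw [zero_mul, add_zero, ← C_mul, inv_mul_cancel₀ hα, C_1]⟩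
  rw [isChenPair_iff_isChenModulus f g (by rintro rfl; simp at hf), hg,
    isChenModulus_mul hcα, isChenModulus_prod _ _ hcop,
    Finset.lt_inf_iff (WithTop.coe_lt_top _)]
  simp only [isChenModulus_of_isUnit _ hu, true_and]
  exact forall₂_congr fun i _ => (isChenModulus_pow_iff (hPirr i) (hPmonic i) (he i)).trans
    (natCast_lt_gammaPow_iff (hPirr i).natDegree_pos (he i)).symm
end
end

section
/- Let g ∈ A be non-constant. If q = 2, then (g, g) is a Chen pair if and only if x³ ∤ g, (x+1)³ ∤ g, and P² ∤ g for every irreducible polynomial P with deg P ≥ 2. If q > 2, then (g, g) is a Chen pair if and only if g is square-free. -/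
open Polynomial

noncomputable section

variable {F : Type*} [Field F] [Fintype F]

/-- Chen pairs `(g, g)` expressed through functions on polynomials rather than on residue
classes. -/
def EveryCongPresIsPoly (g : Polynomial F) : Prop :=
  ∀ s : Polynomial F → Polynomial F,
    (∀ d h₁ h₂, d ∣ g → d ∣ h₁ - h₂ → d ∣ s h₁ - s h₂) →
      ∃ G : Polynomial (Polynomial F), ∀ h, g ∣ s h - G.eval h

theorem mk_span_singleton_eq_iff {F : Type*} [Field F] {g a b : Polynomial F} :
    Ideal.Quotient.mk (Ideal.span {g}) a = Ideal.Quotient.mk (Ideal.span {g}) b ↔ g ∣ a - b := by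
  rw [Ideal.Quotient.eq, Ideal.mem_span_singleton]

theorem dvd_mod_sub_self {F : Type*} [Field F] (g h : Polynomial F) : g ∣ h % g - h :=
  ⟨-(h / g), by linear_combination EuclideanDomain.div_add_mod h g⟩

theorem isChenPair_self_iff_everyCongPresIsPoly {F : Type*} [Field F]
    {g : Polynomial F} (hg : g ≠ 0) :
    IsChenPair g g ↔ EveryCongPresIsPoly g := by
  constructor
  · intro H s hs
    have hout (h : Polynomial F) :
        g ∣ s (Quotient.out (Ideal.Quotient.mk (Ideal.span {g}) h)) - s h := by
      apply hs g _ _ dvd_rfl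
      rw [← mk_span_singleton_eq_iff]
      exact Quotient.out_eq _
    obtain ⟨G, hG⟩ := H (fun c => Ideal.Quotient.mk _ (s (Quotient.out c))) (by
      intro h₁ h₂ d _ _ hd h12 s₁ s₂ e₁ e₂
      rw [mk_span_singleton_eq_iff] at e₁ e₂
      have t₁ := hd.trans (dvd_add e₁ (hout h₁))
      have t₂ := hd.trans (dvd_add e₂ (hout h₂))
      have t := dvd_add (dvd_sub t₁ t₂) (hs d h₁ h₂ hd h12)
      ring_nf at t ⊢
      exact t)
    refine ⟨G, fun h => ?_⟩
    have h0 := hG (h % g) (EuclideanDomain.mod_lt h hg)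
    rw [mk_span_singleton_eq_iff] at h0
    have h1 := hs g (h % g) h dvd_rfl (dvd_mod_sub_self g h)
    have h2 := (dvd_mod_sub_self g h).trans (sub_dvd_eval_sub (h % g) h G)
    have t := dvd_add (dvd_sub (dvd_sub h0 (hout (h % g))) h1) h2
    ring_nf at t ⊢
    exact t
  · intro H σ hσ
    have hmod (h : Polynomial F) : Ideal.Quotient.mk (Ideal.span {g}) (h % g) =
        Ideal.Quotient.mk (Ideal.span {g}) h :=
      mk_span_singleton_eq_iff.2 (dvd_mod_sub_self g h)
    have hout (c : Polynomial F ⧸ Ideal.span {g}) :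
        Ideal.Quotient.mk (Ideal.span {g}) (Quotient.out c) = c := Quotient.out_eq c
    obtain ⟨G, hG⟩ := H (fun h => Quotient.out (σ (Ideal.Quotient.mk _ h))) (by
      intro d h₁ h₂ hd h12
      refine hσ (h₁ % g) (h₂ % g) d (EuclideanDomain.mod_lt _ hg) (EuclideanDomain.mod_lt _ hg)
        hd ?_ _ _ ?_ ?_
      · have t := dvd_add (dvd_sub (hd.trans (dvd_mod_sub_self g h₁))
          (hd.trans (dvd_mod_sub_self g h₂))) h12
        ring_nf at t ⊢
        exact t
      · rw [hout, hmod]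
      · rw [hout, hmod])
    refine ⟨G, fun h _ => ?_⟩
    rw [← mk_span_singleton_eq_iff.2 (hG h), hout]

theorem not_everyCongPresIsPoly_of_nonzero_sum {F : Type*} [Field F]
    {P m u v : Polynomial F} {n : ℕ}
    (hP : Irreducible P) (hm : ¬ P ∣ m) (hPu : P ∣ u) (hPv : P ^ (n + 1) ∣ v)
    (hu : ¬ P ^ (n + 2) ∣ u) (hv : ¬ P ^ (n + 2) ∣ v) (huv : ¬ P ^ (n + 2) ∣ u + v) :
    ¬ EveryCongPresIsPoly (P ^ (n + 2) * m) := by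
  classical
  intro H
  obtain ⟨G, hG⟩ := H (fun h => if P ^ (n + 2) ∣ h then P ^ (n + 1) * m else 0) (by
    intro d h₁ h₂ hd h12
    by_cases hPd : P ^ (n + 2) ∣ d
    · have : P ^ (n + 2) ∣ h₁ ↔ P ^ (n + 2) ∣ h₂ := dvd_iff_dvd_of_dvd_sub (hPd.trans h12)
      simp [this]
    · have key : d ∣ P ^ (n + 1) * m := by
        obtain ⟨k, hk⟩ := hd
        by_cases hPk : P ∣ k
        · obtain ⟨k', rfl⟩ := hPk
          refine ⟨k', mul_left_cancel₀ hP.ne_zero ?_⟩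
          linear_combination hk
        · exact absurd (hP.prime.pow_dvd_of_dvd_mul_right _ hPk (hk ▸ dvd_mul_right _ _)) hPd
      split_ifs <;> simp [key])
  have hG' (h : Polynomial F) := (dvd_mul_right (P ^ (n + 2)) m).trans (hG h)
  have h0 := hG' 0
  have h1 := hG' u
  have h2 := hG' v
  have h3 := hG' (u + v)
  simp only [hu, hv, huv, dvd_zero, if_true, if_false] at h0 h1 h2 h3
  obtain ⟨k₁, e₁⟩ := G.binomExpansion u v
  obtain ⟨k₂, e₂⟩ := G.binomExpansion 0 v
  rw [zero_add] at e₂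
  have hd : P ∣ G.derivative.eval u - G.derivative.eval 0 :=
    hPu.trans (by simpa using sub_dvd_eval_sub u 0 G.derivative)
  have hdv : P ^ (n + 2) ∣ (G.derivative.eval u - G.derivative.eval 0) * v := by
    rw [pow_succ']
    exact mul_dvd_mul hd hPv
  have hv2 : P ^ (n + 2) ∣ v ^ 2 := by
    refine (pow_dvd_pow P (show n + 2 ≤ (n + 1) * 2 by omega)).trans ?_
    rw [pow_mul]
    exact pow_dvd_pow_of_dvd hPv 2
  have t : P ^ (n + 2) ∣ P ^ (n + 1) * m := by
    have t₁ := dvd_add (dvd_add (dvd_sub (dvd_sub h0 h1) h2) h3)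
      (dvd_add hdv (hv2.mul_left (k₁ - k₂)))
    convert t₁ using 1
    linear_combination e₁ - e₂
  rw [pow_succ, mul_dvd_mul_iff_left (pow_ne_zero _ hP.ne_zero)] at t
  exact hm t

theorem EveryCongPresIsPoly.not_sq_dvd {F : Type*} [Field F] {g P b : Polynomial F} (hg : g ≠ 0)
    (hP : Irreducible P) (hb : ¬ P ∣ b) (hb' : ¬ P ∣ 1 + b) (H : EveryCongPresIsPoly g) :
    ¬ P ^ 2 ∣ g := by
  intro h2
  obtain ⟨e, m, hm, rfl⟩ := WfDvdMonoid.max_power_factor hg hP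
  obtain ⟨n, rfl⟩ : ∃ n, e = n + 2 := by
    refine ⟨e - 2, (Nat.sub_add_cancel ?_).symm⟩
    exact (pow_dvd_pow_iff hP.ne_zero hP.not_isUnit).1
      (hP.prime.pow_dvd_of_dvd_mul_right _ hm h2)
  have hcancel (c : Polynomial F) : P ^ (n + 2) ∣ P ^ (n + 1) * c ↔ P ∣ c := by
    rw [pow_succ P (n + 1), mul_dvd_mul_iff_left (pow_ne_zero _ hP.ne_zero)]
  refine not_everyCongPresIsPoly_of_nonzero_sum (u := P ^ (n + 1) * 1) (v := P ^ (n + 1) * b)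
    hP hm ?_ (dvd_mul_right _ _) ?_ ?_ ?_ H
  · rw [mul_one]
    exact dvd_pow_self _ (by omega)
  · rw [hcancel]
    exact fun h => hP.not_isUnit (isUnit_of_dvd_one h)
  · rwa [hcancel]
  · rwa [← mul_add, hcancel]

theorem EveryCongPresIsPoly.not_cube_dvd {F : Type*} [Field F] {g P : Polynomial F} (hg : g ≠ 0)
    (hP : Irreducible P) (H : EveryCongPresIsPoly g) : ¬ P ^ 3 ∣ g := by
  intro h3
  obtain ⟨e, m, hm, rfl⟩ := WfDvdMonoid.max_power_factor hg hP
  obtain ⟨n, rfl⟩ : ∃ n, e = n + 1 + 2 := by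
    refine ⟨e - 3, ?_⟩
    have := (pow_dvd_pow_iff hP.ne_zero hP.not_isUnit).1
      (hP.prime.pow_dvd_of_dvd_mul_right _ hm h3)
    omega
  have hunit (c : Polynomial F) : ¬ P ∣ 1 + P * c := fun h =>
    hP.not_isUnit (isUnit_of_dvd_one ((dvd_add_left (dvd_mul_right P c)).1 h))
  have hcancel (c : Polynomial F) : P ^ (n + 1 + 2) ∣ P ^ (n + 1) * c ↔ P ^ 2 ∣ c := by
    rw [pow_add P (n + 1), mul_dvd_mul_iff_left (pow_ne_zero _ hP.ne_zero)]
  have hsq {c : Polynomial F} (h : P ^ 2 ∣ c) : P ∣ c := (dvd_pow_self P two_ne_zero).trans h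
  refine not_everyCongPresIsPoly_of_nonzero_sum (u := P ^ (n + 1) * 1) (v := P ^ (n + 1) * P)
    hP hm ?_ (dvd_of_eq (pow_succ _ _)) ?_ ?_ ?_ H
  · rw [mul_one]
    exact dvd_pow_self _ (by omega)
  · rw [hcancel]
    exact fun h => hunit 0 (by simpa using hsq h)
  · rw [hcancel]
    intro h
    have := (pow_dvd_pow_iff hP.ne_zero hP.not_isUnit).1 (h.trans (dvd_of_eq (pow_one P).symm))
    omega
  · rw [← mul_add, hcancel]
    exact fun h => hunit 1 (by simpa using hsq h)

theorem EveryCongPresIsPoly.mul {F : Type*} [Field F] {a b : Polynomial F} (hab : IsCoprime a b)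
    (ha : EveryCongPresIsPoly a) (hb : EveryCongPresIsPoly b) :
    EveryCongPresIsPoly (a * b) := by
  intro s hs
  obtain ⟨Ga, hGa⟩ := ha s fun d h₁ h₂ hd => hs d h₁ h₂ (hd.mul_right b)
  obtain ⟨Gb, hGb⟩ := hb s fun d h₁ h₂ hd => hs d h₁ h₂ (hd.mul_left a)
  have ⟨u, v, huv⟩ := hab
  refine ⟨C (v * b) * Ga + C (u * a) * Gb, fun h => hab.mul_dvd ?_ ?_⟩
  · obtain ⟨k, hk⟩ := hGa h
    refine ⟨k + u * (Ga.eval h - Gb.eval h), ?_⟩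
    simp only [eval_add, eval_mul, eval_C]
    linear_combination hk - Ga.eval h * huv
  · obtain ⟨k, hk⟩ := hGb h
    refine ⟨k + v * (Gb.eval h - Ga.eval h), ?_⟩
    simp only [eval_add, eval_mul, eval_C]
    linear_combination hk - Gb.eval h * huv

theorem everyCongPresIsPoly_of_irreducible {P : Polynomial F} (hP : Irreducible P) :
    EveryCongPresIsPoly P := by
  classical
  intro s hs
  let K := Polynomial F ⧸ Ideal.span {P}
  have : (Ideal.span {P}).IsMaximal := PrincipalIdealRing.isMaximal_of_irreducible hP
  let : Field K := Ideal.Quotient.field _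
  have hfin : Finite K := by
    have : Module.Finite F (AdjoinRoot P) := (AdjoinRoot.powerBasis hP.ne_zero).finite
    exact Module.finite_of_finite F (M := AdjoinRoot P)
  let : Fintype K := Fintype.ofFinite K
  let φ : Polynomial F →+* K := Ideal.Quotient.mk (Ideal.span {P})
  have hφ : Function.Surjective φ := Ideal.Quotient.mk_surjective
  obtain ⟨G, hG⟩ := Polynomial.map_surjective φ hφ
    (Lagrange.interpolate Finset.univ id fun c : K => φ (s (Function.surjInv hφ c)))
  refine ⟨G, fun h => ?_⟩
  have e : φ (G.eval h) = φ (s (Function.surjInv hφ (φ h))) := by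
    rw [← eval_map_apply, hG]
    exact Lagrange.eval_interpolate_at_node (v := id) _ (Set.injOn_id _) (Finset.mem_univ (φ h))
  have h₁ := hs P (Function.surjInv hφ (φ h)) h dvd_rfl
    (mk_span_singleton_eq_iff.1 (Function.surjInv_eq hφ (φ h)))
  rw [← neg_sub, dvd_neg]
  have t := dvd_add (mk_span_singleton_eq_iff.1 e) h₁
  ring_nf at t ⊢
  exact t

theorem everyCongPresIsPoly_sq {F : Type*} [Field F]
    {P : Polynomial F} (hF : (2 : Polynomial F) = 0)
    (hP : ∀ h, P ∣ h ∨ P ∣ h - 1) : EveryCongPresIsPoly (P ^ 2) := by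
  intro s hs
  obtain ⟨α, hα⟩ := hs P P 0 (dvd_pow_self P two_ne_zero) (by simp)
  obtain ⟨β, hβ⟩ := hs P (1 + P) 1 (dvd_pow_self P two_ne_zero) (by simp)
  obtain ⟨G, hG⟩ : ∃ G : Polynomial (Polynomial F), G =
    C (s 0) + C (s 1 - s 0) * X ^ 2 + (X - X ^ 2) * (C α + C (β - α) * X) := ⟨_, rfl⟩
  have key {r h : Polynomial F} (hr : P ^ 2 ∣ s r - G.eval r) (hh : P ^ 2 ∣ h - r) :
      P ^ 2 ∣ s h - G.eval h := by
    have t := dvd_sub (dvd_add hr (hs _ _ _ dvd_rfl hh)) (hh.trans (sub_dvd_eval_sub h r G))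
    ring_nf at t ⊢
    exact t
  refine ⟨G, fun h => ?_⟩
  rcases hP h with ⟨k, hk⟩ | ⟨k, hk⟩ <;> rcases hP k with ⟨l, hl⟩ | ⟨l, hl⟩
  · refine key (r := 0) ?_ ⟨l, ?_⟩
    · simp [hG]
    · linear_combination hk + P * hl
  · refine key (r := P) ?_ ⟨l, ?_⟩
    · refine ⟨- (s 1 - s 0) - (β - α) * (1 - P) + α, ?_⟩
      simp only [hG, eval_add, eval_mul, eval_sub, eval_pow, eval_C, eval_X]
      linear_combination hα
    · linear_combination hk + P * hl
  · refine key (r := 1) ?_ ⟨l, ?_⟩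
    · simp [hG]
    · linear_combination hk + P * hl
  · refine key (r := 1 + P) ?_ ⟨l, ?_⟩
    · refine ⟨- (s 1 - s 0) + β + (β - α) * (1 + P), ?_⟩
      simp only [hG, eval_add, eval_mul, eval_sub, eval_pow, eval_C, eval_X]
      linear_combination hβ + (P * β - P * (s 1 - s 0)) * hF
    · linear_combination hk + P * hl

theorem dvd_or_dvd_sub_one {P : Polynomial F} (hF : Fintype.card F = 2)
    (hP : P.natDegree = 1) (h : Polynomial F) : P ∣ h ∨ P ∣ h - 1 := by
  have hd : (h % P).degree ≤ 0 := by
    have := EuclideanDomain.mod_lt h (show P ≠ 0 by rintro rfl; simp at hP)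
    have h1 : (h % P).degree < P.degree := this
    rw [degree_eq_natDegree (show P ≠ 0 by rintro rfl; simp at hP), hP] at h1
    exact Order.lt_succ_iff.1 h1
  have hmod := dvd_mod_sub_self P h
  rw [eq_C_of_degree_le_zero hd, ← dvd_neg, neg_sub] at hmod
  by_cases h0 : (h % P).coeff 0 = 0
  · left
    simpa [h0] using hmod
  · right
    have h1 : (h % P).coeff 0 = 1 := by
      simpa [hF] using FiniteField.pow_card_sub_one_eq_one _ h0
    simpa [h1] using hmod

theorem everyCongPresIsPoly_iff {g : Polynomial F} (hg : g ≠ 0) :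
    EveryCongPresIsPoly g ↔ ∀ P : Polynomial F, Irreducible P → P ^ 2 ∣ g →
      Fintype.card F = 2 ∧ P.natDegree = 1 ∧ ¬ P ^ 3 ∣ g := by
  classical
  constructor
  · intro H P hP h2
    refine ⟨?_, ?_, H.not_cube_dvd hg hP⟩
    · by_contra hF
      have hF' : 2 < Fintype.card F := lt_of_le_of_ne Fintype.one_lt_card (Ne.symm hF)
      obtain ⟨c, hc⟩ : ∃ c : F, c ∉ ({0, -1} : Finset F) := by
        by_contra! hall
        have := Finset.card_le_two (a := (0 : F)) (b := -1)
        rw [Finset.eq_univ_iff_forall.2 hall, Finset.card_univ] at this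
        omega
      simp only [Finset.mem_insert, Finset.mem_singleton, not_or] at hc
      have hnd {a : F} (ha : a ≠ 0) : ¬ P ∣ C a := fun h =>
        hP.not_isUnit (isUnit_of_dvd_unit h (isUnit_C.2 ha.isUnit))
      refine H.not_sq_dvd hg hP (hnd hc.1) ?_ h2
      rw [← C_1, ← C_add]
      exact hnd fun h => hc.2 (eq_neg_of_add_eq_zero_right h)
    · by_contra hdeg
      have hdeg' : 1 < P.natDegree := lt_of_le_of_ne hP.natDegree_pos (Ne.symm hdeg)
      refine H.not_sq_dvd (b := X) hg hP ?_ ?_ h2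
      · exact fun h => absurd (natDegree_le_of_dvd h X_ne_zero) (by simpa using hdeg')
      · rw [add_comm, ← C_1]
        exact fun h => absurd (natDegree_le_of_dvd h (X_add_C_ne_zero 1)) (by
          simpa only [natDegree_X_add_C, not_le] using hdeg')
  · intro H
    induction g using UniqueFactorizationMonoid.induction_on_coprime with
    | h0 => exact absurd rfl hg
    | h1 hx => exact fun _ _ => ⟨0, fun _ => hx.dvd⟩
    | hpr i hp =>
      rename_i p
      match i with
      | 0 => exact fun _ _ => ⟨0, fun _ => by simp⟩
      | 1 => simpa using everyCongPresIsPoly_of_irreducible hp.irreducible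
      | 2 =>
        obtain ⟨hF, hdeg, -⟩ := H p hp.irreducible dvd_rfl
        refine everyCongPresIsPoly_sq ?_ (dvd_or_dvd_sub_one hF hdeg)
        have := Nat.cast_card_eq_zero F
        rw [hF] at this
        rw [← C_0, ← this]
        simp only [Nat.cast_ofNat, C_ofNat]
      | n + 3 =>
        exact absurd (pow_dvd_pow p (by omega))
          (H p hp.irreducible (pow_dvd_pow p (by omega))).2.2
    | hcp hxy ihx ihy =>
      refine .mul hxy.isCoprime (ihx (left_ne_zero_of_mul hg) fun P hP h2 => ?_)
        (ihy (right_ne_zero_of_mul hg) fun P hP h2 => ?_)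
      · obtain ⟨hF, hd, h3⟩ := H P hP (h2.mul_right _)
        exact ⟨hF, hd, fun h => h3 (h.mul_right _)⟩
      · obtain ⟨hF, hd, h3⟩ := H P hP (h2.mul_left _)
        exact ⟨hF, hd, fun h => h3 (h.mul_left _)⟩

/-- Corollary: Chen pairs `(g,g)`.
If `q = 2`: `(g,g)` is a Chen pair iff `x³ ∤ g`, `(x+1)³ ∤ g`, and `P² ∤ g` for every
irreducible `P` of degree `≥ 2`. If `q > 2`: `(g,g)` is a Chen pair iff `g` is square-free. -/
theorem chenPair_self_iff (g : Polynomial F) (hg : 1 ≤ g.natDegree) :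
    (Fintype.card F = 2 →
      (IsChenPair g g ↔
        ¬ (X : Polynomial F) ^ 3 ∣ g ∧ ¬ ((X : Polynomial F) + 1) ^ 3 ∣ g ∧
          ∀ P : Polynomial F, Irreducible P → 2 ≤ P.natDegree → ¬ P ^ 2 ∣ g)) ∧
    (2 < Fintype.card F → (IsChenPair g g ↔ Squarefree g)) := by
  have hg0 : g ≠ 0 := by
    rintro rfl
    simp at hg
  rw [isChenPair_self_iff_everyCongPresIsPoly hg0, everyCongPresIsPoly_iff hg0]
  refine ⟨fun hF => ⟨fun H => ⟨?_, ?_, ?_⟩, ?_⟩, fun hF => ?_⟩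
  · exact fun h => (H X irreducible_X ((pow_dvd_pow X (by omega)).trans h)).2.2 h
  · have hX : Irreducible ((X : Polynomial F) + 1) := by
      simpa using (monic_X_add_C (1 : F)).irreducible_of_degree_eq_one (degree_X_add_C 1)
    exact fun h => (H _ hX ((pow_dvd_pow _ (by omega)).trans h)).2.2 h
  · intro P hP hdeg h
    have := (H P hP h).2.1
    omega
  · rintro ⟨h0, h1, h2⟩ P hP hsq
    have hdeg : P.natDegree = 1 := by
      have := hP.natDegree_pos
      have := mt (h2 P hP) (not_not.2 hsq)
      omega
    refine ⟨hF, hdeg, ?_⟩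
    have hone {a : F} (ha : a ≠ 0) : a = 1 := by
      simpa [hF] using FiniteField.pow_card_sub_one_eq_one a ha
    have hlead : P.coeff 1 = 1 := hone (by
      rw [← hdeg]
      exact leadingCoeff_ne_zero.2 hP.ne_zero)
    have hPX : P = X + C (P.coeff 0) := by
      conv_lhs => rw [eq_X_add_C_of_natDegree_le_one hdeg.le, hlead, C_1, one_mul]
    by_cases hc : P.coeff 0 = 0
    · rw [hc, C_0, add_zero] at hPX
      rwa [hPX]
    · rw [hone hc, C_1] at hPX
      rwa [hPX]
  · rw [squarefree_iff_no_irreducibles hg0]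
    refine forall₂_congr fun P _ => ?_
    rw [← pow_two]
    exact ⟨fun H h => hF.ne' (H h).1, fun H h => absurd h H⟩
end
end

section
/- The natural density ρ = lim_{m→∞} #{g ∈ A : 1 ≤ deg g ≤ m and (g,g) is a Chen pair} / #{g ∈ A : 1 ≤ deg g ≤ m} exists and equals 49/72 if q = 2, and equals (q−1)/q if q > 2. -/
open Polynomial

noncomputable section

variable {F : Type*} [Field F] [Fintype F]

/-- The largest exponent with which `P` may occur in the modulus of a Chen pair `(g, g)`. -/
def chenExponent (P : Polynomial F) : ℕ :=
  if Fintype.card F = 2 ∧ P.natDegree = 1 then 2 else 1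

/-- No monic irreducible `P` occurs in `g` with an exponent exceeding `e P`. -/
def PowerFree {K : Type*} [Field K] (e : K[X] → ℕ) (g : K[X]) : Prop :=
  ∀ P : K[X], P.Monic → Irreducible P → ¬ P ^ (e P + 1) ∣ g

theorem mul_dvd_eval_add_sub {R : Type*} [CommRing R] (G : R[X]) (x y : R) :
    x * y ∣ G.eval (x + y) - G.eval x - G.eval y + G.eval 0 := by
  obtain ⟨a, ha⟩ : y ∣ G.divX.eval (x + y) - G.divX.eval x := by
    simpa using sub_dvd_eval_sub (x + y) x G.divX
  obtain ⟨b, hb⟩ : x ∣ G.divX.eval (x + y) - G.divX.eval y := by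
    simpa using sub_dvd_eval_sub (x + y) y G.divX
  refine ⟨a + b, ?_⟩
  rw [← divX_mul_X_add G]
  simp only [eval_add, eval_mul, eval_X, eval_C]
  linear_combination x * ha + y * hb

theorem isChenPair_self_iff {K : Type*} [Field K] {g : K[X]} (hg : g ≠ 0) :
    IsChenPair g g ↔ ∀ s : K[X] → K[X], (∀ d a b, d ∣ g → d ∣ a - b → d ∣ s a - s b) →
      ∃ G : K[X][X], ∀ h, g ∣ G.eval h - s h := by
  have hmk : ∀ a b : K[X], Ideal.Quotient.mk (Ideal.span {g}) a = Ideal.Quotient.mk _ b ↔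
      g ∣ a - b := fun a b => by rw [Ideal.Quotient.eq, Ideal.mem_span_singleton]
  have hmod : ∀ a : K[X], g ∣ a - a % g := fun a =>
    ⟨a / g, by linear_combination - EuclideanDomain.div_add_mod a g⟩
  have hlt : ∀ a : K[X], (a % g).degree < g.degree := fun a => degree_mod_lt a hg
  have hout : ∀ x : K[X] ⧸ Ideal.span {g},
      Ideal.Quotient.mk _ (Function.surjInv Ideal.Quotient.mk_surjective x) = x :=
    Function.surjInv_eq _
  constructor
  · intro h s hs
    let σ : K[X] ⧸ Ideal.span {g} → K[X] ⧸ Ideal.span {g} := fun x =>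
      Ideal.Quotient.mk _ (s (Function.surjInv Ideal.Quotient.mk_surjective x))
    have hσ : ∀ a, σ (Ideal.Quotient.mk _ a) = Ideal.Quotient.mk _ (s a) := fun a =>
      (hmk _ _).2 (hs _ _ _ dvd_rfl ((hmk _ _).1 (hout _)))
    obtain ⟨G, hG⟩ := h σ (by
      intro a b d _ _ hd hab s₁ s₂ h₁ h₂
      rw [hσ, hmk] at h₁ h₂
      have := dvd_add (dvd_sub (hd.trans h₁) (hd.trans h₂)) (hs d a b hd hab)
      convert this using 1
      ring)
    refine ⟨G, fun a => ?_⟩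
    have h₁ := hG _ (hlt a)
    rw [hσ, eq_comm, hmk] at h₁
    have h₂ := hs g _ _ dvd_rfl (hmod a)
    have h₃ := (hmod a).trans (sub_dvd_eval_sub a (a % g) G)
    convert dvd_sub (dvd_add h₁ h₃) h₂ using 1
    ring
  · intro h σ hσ
    obtain ⟨G, hG⟩ := h
      (fun a => Function.surjInv Ideal.Quotient.mk_surjective (σ (Ideal.Quotient.mk _ a))) (by
        intro d a b hd hab
        have key : ∀ a : K[X],
            Ideal.Quotient.mk (Ideal.span {g}) a = Ideal.Quotient.mk _ (a % g) :=
          fun a => (hmk _ _).2 (hmod a)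
        refine hσ (a % g) (b % g) d (hlt a) (hlt b) hd ?_ _ _
          (by rw [hout, key]) (by rw [hout, key])
        convert dvd_add (dvd_sub hab (hd.trans (hmod a))) (hd.trans (hmod b)) using 1
        ring)
    refine ⟨G, fun a _ => ?_⟩
    rw [← hout (σ _), eq_comm, hmk]
    exact hG a

theorem not_isChenPair_of_pow_mul {K : Type*} [Field K] {P u c : K[X]} {n : ℕ}
    (hn : 2 ≤ n) (hP : Prime P) (hu : ¬ P ∣ u) (hc : ¬ P ∣ c)
    (hsum : ¬ P ^ n ∣ P + P ^ (n - 1) * c) :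
    ¬ IsChenPair (P ^ n * u) (P ^ n * u) := by
  classical
  have hu0 : u ≠ 0 := fun h => hu (h ▸ dvd_zero P)
  have hg : P ^ n * u ≠ 0 := mul_ne_zero (pow_ne_zero _ hP.ne_zero) hu0
  obtain ⟨k, rfl⟩ : ∃ k, n = k + 2 := ⟨n - 2, by omega⟩
  simp only [Nat.add_succ_sub_one] at hsum
  rw [isChenPair_self_iff hg]
  intro h
  obtain ⟨G, hG⟩ := h (fun a => if P ^ (k + 2) ∣ a then P ^ (k + 1) * u else 0) (by
    intro d a b hd hab
    by_cases hPd : P ^ (k + 2) ∣ d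
    · have : P ^ (k + 2) ∣ a ↔ P ^ (k + 2) ∣ b := (dvd_iff_dvd_of_dvd_sub (hPd.trans hab))
      simp [this]
    · have : d ∣ P ^ (k + 1) * u := by
        obtain ⟨m, v, hm, hd'⟩ : ∃ m v, ¬ P ∣ v ∧ d = P ^ m * v := by
          have hd0 : d ≠ 0 := ne_zero_of_dvd_ne_zero hg hd
          exact (FiniteMultiplicity.of_prime_left hP hd0).exists_eq_pow_mul_and_not_dvd.elim
            fun v hv => ⟨_, v, hv.2, hv.1⟩
        subst hd'
        have hmk : m ≤ k + 1 := by
          by_contra hcon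
          exact hPd ((pow_dvd_pow P (by omega)).trans (dvd_mul_right _ _))
        refine mul_dvd_mul (pow_dvd_pow _ hmk) ?_
        refine IsCoprime.dvd_of_dvd_mul_left ?_ ((dvd_mul_left v _).trans hd)
        exact ((hP.irreducible.coprime_iff_not_dvd.2 hm).pow_left).symm
      split_ifs <;> simp [this])
  have hG' : ∀ a, P ^ (k + 2) ∣ G.eval a - if P ^ (k + 2) ∣ a then P ^ (k + 1) * u else 0 :=
    fun a => (dvd_mul_right _ _).trans (hG a)
  have h0 := hG' 0
  have h1 := hG' P
  have h2 := hG' (P ^ (k + 1) * c)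
  have h3 := hG' (P + P ^ (k + 1) * c)
  have hcan : ∀ x, P ^ (k + 2) ∣ P ^ (k + 1) * x → P ∣ x := fun x hx => by
    rw [pow_succ] at hx
    exact (mul_dvd_mul_iff_left (pow_ne_zero _ hP.ne_zero)).1 hx
  have hP1 : ¬ P ^ (k + 2) ∣ P := fun h => hP.not_isUnit <| by
    rw [← isUnit_pow_iff (n := k + 1) (by omega)]
    refine isUnit_of_dvd_one ((mul_dvd_mul_iff_left hP.ne_zero).1 ?_)
    rwa [mul_one, ← pow_succ']
  rw [if_pos (dvd_zero _)] at h0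
  rw [if_neg hP1] at h1
  rw [if_neg fun h => hc (hcan _ h)] at h2
  rw [if_neg hsum] at h3
  have h4 := mul_dvd_eval_add_sub G P (P ^ (k + 1) * c)
  have h5 : P ^ (k + 2) ∣ P * (P ^ (k + 1) * c) := ⟨c, by ring⟩
  refine hu (hcan _ ?_)
  convert dvd_sub (h5.trans h4) (dvd_add (dvd_sub (dvd_sub h3 h1) h2) h0) using 1
  ring

theorem exists_forall_dvd_eval_sub_of_prime {P : F[X]} (hP : Prime P) (s : F[X] → F[X])
    (hs : ∀ a b, P ∣ a - b → P ∣ s a - s b) :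
    ∃ G : F[X][X], ∀ h, P ∣ G.eval h - s h := by
  classical
  have : Fact (Irreducible P) := ⟨hP.irreducible⟩
  have : Module.Finite F (AdjoinRoot P) := (AdjoinRoot.powerBasis hP.ne_zero).finite
  have : Finite (AdjoinRoot P) := Module.finite_of_finite F
  have := Fintype.ofFinite (AdjoinRoot P)
  have hsurj := AdjoinRoot.mk_surjective (g := P)
  obtain ⟨G, hG⟩ := map_surjective (AdjoinRoot.mk P) hsurj
    (Lagrange.interpolate Finset.univ id
      fun x => AdjoinRoot.mk P (s (Function.surjInv hsurj x)))
  refine ⟨G, fun h => ?_⟩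
  have h₁ := Lagrange.eval_interpolate_at_node (s := Finset.univ) (v := id)
    (i := AdjoinRoot.mk P h) (fun x => AdjoinRoot.mk P (s (Function.surjInv hsurj x)))
    Function.injective_id.injOn (Finset.mem_univ _)
  rw [← hG, id, eval_map, eval₂_at_apply, AdjoinRoot.mk_eq_mk] at h₁
  have h₂ := hs _ _ (AdjoinRoot.mk_eq_mk.1 (Function.surjInv_eq hsurj (AdjoinRoot.mk P h)))
  convert dvd_add h₁ h₂ using 1
  ring

theorem exists_forall_sq_dvd_eval_sub {R : Type*} [CommRing R] {P : R}
    (hP : ∀ h, P ∣ h ∨ P ∣ h - 1) (s : R → R) (hs : ∀ a b, P ∣ a - b → P ∣ s a - s b)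
    (hs₂ : ∀ a b, P ^ 2 ∣ a - b → P ^ 2 ∣ s a - s b) :
    ∃ G : R[X], ∀ h, P ^ 2 ∣ G.eval h - s h := by
  obtain ⟨u, hu⟩ := hs P 0 (by simp)
  obtain ⟨v, hv⟩ := hs (1 + P) 1 (by simp)
  let w₀ := s 1 - s 0 - u
  let w₁ := v - (s 1 - s 0)
  let G : R[X] := C (s 0) + C (s 1 - s 0) * X + X * (X - 1) * (C w₀ + C (w₁ - w₀) * X)
  have key : ∀ r h, P ^ 2 ∣ G.eval r - s r → P ^ 2 ∣ h - r → P ^ 2 ∣ G.eval h - s h := by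
    intro r h h₁ h₂
    convert dvd_sub (dvd_add h₁ (h₂.trans (sub_dvd_eval_sub h r G))) (hs₂ _ _ h₂) using 1
    ring
  refine ⟨G, fun h => ?_⟩
  rcases hP h with ⟨k, hk⟩ | ⟨k, hk⟩ <;> rcases hP k with ⟨j, hj⟩ | ⟨j, hj⟩
  · exact key 0 h (by simp [G]) ⟨j, by rw [hk, hj]; ring⟩
  · refine key P h ⟨w₀ + (P - 1) * (w₁ - w₀), ?_⟩ ⟨j, by linear_combination hk + P * hj⟩
    simp only [G, w₀, w₁, eval_add, eval_mul, eval_C, eval_X, eval_sub, eval_one]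
    linear_combination -hu
  · refine key 1 h ?_ ⟨j, by linear_combination hk + P * hj⟩
    simp [G]
  · refine key (1 + P) h ⟨w₁ + (1 + P) * (w₁ - w₀), ?_⟩ ⟨j, by linear_combination hk + P * hj⟩
    simp only [G, w₀, w₁, eval_add, eval_mul, eval_C, eval_X, eval_sub, eval_one]
    linear_combination -hv

theorem eq_zero_or_eq_one_of_card_eq_two (h2 : Fintype.card F = 2) (a : F) : a = 0 ∨ a = 1 := by
  by_contra! h
  classical
  have := Finset.card_le_univ ({0, 1, a} : Finset F)
  rw [h2, Finset.card_insert_of_notMem (by simp [h.1.symm]),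
    Finset.card_insert_of_notMem (by simp [h.2.symm])] at this
  simp at this

theorem dvd_or_dvd_sub_one_of_card_eq_two (h2 : Fintype.card F = 2) {P : F[X]}
    (hP : P.natDegree = 1) (h : F[X]) : P ∣ h ∨ P ∣ h - 1 := by
  have hP0 : P ≠ 0 := by rintro rfl; simp at hP
  have hdeg : (h % P).degree ≤ 0 := by
    have := degree_mod_lt h hP0
    rw [degree_eq_natDegree hP0, hP] at this
    exact Order.lt_succ_iff.1 this
  have hmod := EuclideanDomain.div_add_mod h P
  rw [eq_C_of_degree_le_zero hdeg] at hmod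
  rcases eq_zero_or_eq_one_of_card_eq_two h2 ((h % P).coeff 0) with h0 | h0 <;>
    rw [h0] at hmod
  · exact Or.inl ⟨h / P, by rw [C_0, add_zero] at hmod; exact hmod.symm⟩
  · exact Or.inr ⟨h / P, by rw [C_1] at hmod; linear_combination -hmod⟩

theorem PowerFree.not_pow_dvd {g P : F[X]} (hg : PowerFree chenExponent g)
    (hP : Irreducible P) : ¬ P ^ (chenExponent P + 1) ∣ g := by
  have hlc : IsUnit (C P.leadingCoeff⁻¹) :=
    isUnit_C.2 (inv_ne_zero (leadingCoeff_ne_zero.2 hP.ne_zero)).isUnit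
  have hass : Associated P (P * C P.leadingCoeff⁻¹) := associated_mul_unit_right P _ hlc
  have := hg _ (monic_mul_leadingCoeff_inv hP.ne_zero) (hass.irreducible hP)
  rwa [chenExponent, natDegree_mul_leadingCoeff_inv _ hP.ne_zero, ← chenExponent,
    ← (hass.pow_pow).dvd_iff_dvd_left] at this

theorem isChenPair_of_powerFree {g : F[X]} (hg0 : g ≠ 0) (hg : PowerFree chenExponent g) :
    IsChenPair g g := by
  rw [isChenPair_self_iff hg0]
  intro s hs
  suffices h : ∀ d, d ∣ g → ∃ G : F[X][X], ∀ h, d ∣ G.eval h - s h from h g dvd_rfl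
  intro d
  induction d using UniqueFactorizationMonoid.induction_on_coprime with
  | h0 => exact fun h => absurd (zero_dvd_iff.1 h) hg0
  | h1 hu => exact fun _ => ⟨0, fun h => hu.dvd⟩
  | @hpr P i hP =>
    intro hPg
    have hi : i < chenExponent P + 1 := by
      by_contra! h
      exact hg.not_pow_dvd hP.irreducible ((pow_dvd_pow P h).trans hPg)
    have hi' : i = 0 ∨ i = 1 ∨ (i = 2 ∧ Fintype.card F = 2 ∧ P.natDegree = 1) := by
      rw [chenExponent] at hi
      split_ifs at hi with h
      · interval_cases i <;> simp [h]
      · omega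
    rcases hi' with rfl | rfl | ⟨rfl, h2, hdeg⟩
    · exact ⟨0, fun h => by simp⟩
    · rw [pow_one] at hPg ⊢
      exact exists_forall_dvd_eval_sub_of_prime hP s fun a b => hs P a b hPg
    · exact exists_forall_sq_dvd_eval_sub (dvd_or_dvd_sub_one_of_card_eq_two h2 hdeg) s
        (fun a b => hs P a b ((dvd_pow_self P two_ne_zero).trans hPg)) fun a b => hs _ a b hPg
  | @hcp x y hxy hx hy =>
    intro hd
    obtain ⟨G, hG⟩ := hx ((dvd_mul_right x y).trans hd)
    obtain ⟨H, hH⟩ := hy ((dvd_mul_left y x).trans hd)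
    obtain ⟨a, b, hab⟩ := hxy.isCoprime
    refine ⟨C (b * y) * G + C (a * x) * H, fun h => hxy.isCoprime.mul_dvd ?_ ?_⟩
    · convert dvd_add ((hG h).mul_left (b * y))
        (dvd_mul_right x (a * (H.eval h - s h))) using 1
      simp only [eval_add, eval_mul, eval_C]
      linear_combination s h * hab
    · convert dvd_add ((hH h).mul_left (a * x))
        (dvd_mul_right y (b * (G.eval h - s h))) using 1
      simp only [eval_add, eval_mul, eval_C]
      linear_combination s h * hab

theorem exists_not_dvd_and_not_dvd_one_add {P : F[X]} (hP : Irreducible P)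
    (h : ¬ (Fintype.card F = 2 ∧ P.natDegree = 1)) : ∃ c, ¬ P ∣ c ∧ ¬ P ∣ 1 + c := by
  by_cases h2 : Fintype.card F = 2
  · have hdeg : 1 < P.natDegree := by
      have := hP.natDegree_pos
      have : P.natDegree ≠ 1 := fun h1 => h ⟨h2, h1⟩
      omega
    have hX : (1 + X : F[X]).natDegree = 1 := by
      rw [add_comm, ← C_1, natDegree_X_add_C]
    refine ⟨X, fun hd => ?_, fun hd => ?_⟩
    · exact absurd (natDegree_le_of_dvd hd X_ne_zero) (by rw [natDegree_X]; omega)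
    · refine absurd (natDegree_le_of_dvd hd fun h0 => ?_) (by omega)
      simp [h0] at hX
  · have hunit : ∀ a : F, a ≠ 0 → ¬ P ∣ C a := fun a ha hd =>
      hP.not_isUnit (isUnit_of_dvd_unit hd (isUnit_C.2 ha.isUnit))
    classical
    obtain ⟨a, ha⟩ : ∃ a, a ∉ ({0, -1} : Finset F) := by
      by_contra! hall
      have h1 := Finset.card_le_card (fun a _ => hall a : Finset.univ ⊆ ({0, -1} : Finset F))
      have h3 := Fintype.one_lt_card (α := F)
      have h4 := Finset.card_le_two (a := (0 : F)) (b := -1)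
      rw [Finset.card_univ] at h1
      omega
    simp only [Finset.mem_insert, Finset.mem_singleton, not_or] at ha
    refine ⟨C a, hunit a ha.1, ?_⟩
    rw [← C_1, ← C_add]
    exact hunit _ fun h0 => ha.2 (eq_neg_of_add_eq_zero_right h0)

theorem isChenPair_self_iff_powerFree {g : F[X]} (hg0 : g ≠ 0) :
    IsChenPair g g ↔ PowerFree chenExponent g := by
  refine ⟨fun h P _ hP hdvd => ?_, isChenPair_of_powerFree hg0⟩
  obtain ⟨n, u, hu, rfl⟩ : ∃ n u, ¬ P ∣ u ∧ g = P ^ n * u :=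
    (FiniteMultiplicity.of_prime_left hP.prime hg0).exists_eq_pow_mul_and_not_dvd.elim
      fun v hv => ⟨_, v, hv.2, hv.1⟩
  have hn : chenExponent P + 1 ≤ n := by
    have := (hP.coprime_iff_not_dvd.2 hu).pow_left (m := chenExponent P + 1)
      |>.dvd_of_dvd_mul_right hdvd
    exact (pow_dvd_pow_iff hP.ne_zero hP.not_isUnit).1 this
  have hcan : ∀ c, P ^ 2 ∣ P + P * c → P ∣ 1 + c := fun c hc => by
    rw [pow_two, ← mul_one_add] at hc
    exact (mul_dvd_mul_iff_left hP.ne_zero).1 hc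
  have h1 : ¬ P ∣ 1 := fun h => hP.not_isUnit (isUnit_of_dvd_one h)
  by_cases hn3 : 3 ≤ n
  · refine not_isChenPair_of_pow_mul (c := 1) (by omega) hP.prime hu h1 (fun hsum => ?_) h
    obtain ⟨k, rfl⟩ : ∃ k, n = k + 3 := ⟨n - 3, by omega⟩
    have h2 : P ^ 2 ∣ P + P * (P ^ (k + 1) * 1) := by
      convert (pow_dvd_pow P (by omega : 2 ≤ k + 3)).trans hsum using 1
      rw [Nat.add_succ_sub_one]
      ring
    refine h1 ((dvd_add_left ((dvd_pow_self P k.succ_ne_zero).mul_right 1)).1 (hcan _ h2))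
  · have hexp : ¬ (Fintype.card F = 2 ∧ P.natDegree = 1) := fun h => by
      rw [chenExponent, if_pos h] at hn
      omega
    obtain rfl : n = 2 := by
      rw [chenExponent, if_neg hexp] at hn
      omega
    obtain ⟨c, hc, hc1⟩ := exists_not_dvd_and_not_dvd_one_add hP hexp
    exact not_isChenPair_of_pow_mul le_rfl hP.prime hu hc
      (fun hsum => hc1 (hcan c (by simpa using hsum))) h

theorem PowerFree.ne_zero {K : Type*} [Field K] {e : K[X] → ℕ} {g : K[X]}
    (h : PowerFree e g) : g ≠ 0 := by
  rintro rfl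
  exact h X monic_X irreducible_X (dvd_zero _)

theorem powerFree_one_iff_squarefree {K : Type*} [Field K] {g : K[X]} :
    PowerFree (fun _ => 1) g ↔ Squarefree g := by
  constructor
  · intro h
    rw [squarefree_iff_irreducible_sq_not_dvd_of_ne_zero h.ne_zero]
    intro P hP hdvd
    have hlc : IsUnit (C P.leadingCoeff⁻¹) :=
      isUnit_C.2 (inv_ne_zero (leadingCoeff_ne_zero.2 hP.ne_zero)).isUnit
    have hass : Associated P (P * C P.leadingCoeff⁻¹) := associated_mul_unit_right P _ hlc
    refine h _ (monic_mul_leadingCoeff_inv hP.ne_zero) (hass.irreducible hP) ?_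
    rw [← hass.pow_pow.dvd_iff_dvd_left, pow_two]
    exact hdvd
  · intro h P _ hP hdvd
    exact hP.not_isUnit (h P (by rwa [← pow_two]))

theorem ncard_degree_lt (n : ℕ) :
    {g : F[X] | g.degree < n}.Finite ∧ {g : F[X] | g.degree < n}.ncard = Fintype.card F ^ n := by
  have hset : {g : F[X] | g.degree < n} = (degreeLT F n : Set F[X]) := by
    ext g
    simp [mem_degreeLT]
  have e := (degreeLTEquiv F n).toEquiv
  rw [hset]
  have : Finite (degreeLT F n) := Finite.of_equiv _ e.symm
  refine ⟨Set.toFinite _, ?_⟩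
  rw [← Nat.card_coe_set_eq]
  exact (Nat.card_congr e).trans (by simp)

theorem finite_natDegree_le (n : ℕ) : {g : F[X] | g.natDegree ≤ n}.Finite :=
  (ncard_degree_lt (n + 1)).1.subset fun g hg => by
    refine degree_le_natDegree.trans_lt ?_
    exact_mod_cast Nat.lt_succ_of_le hg

theorem ncard_degree_eq (n : ℕ) :
    {g : F[X] | g.degree = n}.ncard + Fintype.card F ^ n = Fintype.card F ^ (n + 1) := by
  rw [← (ncard_degree_lt n).2, ← (ncard_degree_lt (F := F) (n + 1)).2]
  have hset : {g : F[X] | g.degree = n} =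
      {g : F[X] | g.degree < (n + 1 : ℕ)} \ {g : F[X] | g.degree < n} := by
    ext g
    simp only [Set.mem_ofPred_eq, Set.mem_sdiff, not_lt]
    by_cases hg : g = 0
    · simp [hg]
    · rw [degree_eq_natDegree hg]
      norm_cast
      omega
  have hsub : {g : F[X] | g.degree < n} ⊆ {g : F[X] | g.degree < (n + 1 : ℕ)} := fun g hg =>
    lt_trans (Set.mem_ofPred.1 hg) (Nat.cast_lt.2 n.lt_succ_self)
  rw [hset, Set.ncard_sdiff_add_ncard_of_subset hsub (ncard_degree_lt (n + 1)).1]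

theorem card_monic_natDegree_eq (n : ℕ) :
    Nat.card {d : F[X] // d.Monic ∧ d.natDegree = n} = Fintype.card F ^ n := by
  rw [Nat.card_congr ((monicEquivDegreeLT n).trans (degreeLTEquiv F n).toEquiv)]
  simp

theorem exists_sq_mul_squarefree {K : Type*} [Field K] (g : K[X]) (hg : g ≠ 0) :
    ∃ d s : K[X], d.Monic ∧ Squarefree s ∧ d ^ 2 * s = g := by
  induction hn : g.natDegree using Nat.strong_induction_on generalizing g with
  | _ n ih =>
    by_cases hsq : Squarefree g
    · exact ⟨1, g, monic_one, hsq, by ring⟩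
    · rw [Squarefree] at hsq
      push Not at hsq
      obtain ⟨x, ⟨h, rfl⟩, hx⟩ := hsq
      have hx0 : x ≠ 0 := by rintro rfl; simp at hg
      have hh0 : h ≠ 0 := by rintro rfl; simp at hg
      have hdeg : 0 < x.natDegree := natDegree_pos_iff_degree_pos.2
        (degree_pos_of_ne_zero_of_nonunit hx0 hx)
      obtain ⟨d, s, hd, hs, rfl⟩ := ih h.natDegree (by
        rw [← hn, natDegree_mul (mul_ne_zero hx0 hx0) hh0, natDegree_mul hx0 hx0]
        omega) h hh0 rfl
      have hlc : x.leadingCoeff ≠ 0 := leadingCoeff_ne_zero.2 hx0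
      refine ⟨d * (x * C x.leadingCoeff⁻¹), C x.leadingCoeff ^ 2 * s,
        hd.mul (monic_mul_leadingCoeff_inv hx0), ?_, ?_⟩
      · exact (associated_unit_mul_right s _ ((isUnit_C.2 hlc.isUnit).pow 2)).squarefree_iff.1 hs
      · have : C x.leadingCoeff⁻¹ * C x.leadingCoeff = 1 := by
          rw [← C_mul, inv_mul_cancel₀ hlc, C_1]
        linear_combination
          d ^ 2 * x ^ 2 * s * (C x.leadingCoeff⁻¹ * C x.leadingCoeff + 1) * this

theorem dvd_of_sq_mul_eq_sq_mul {K : Type*} [Field K] {a b s t : K[X]} (ha : a ≠ 0)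
    (ht : Squarefree t) (h : a ^ 2 * s = b ^ 2 * t) : a ∣ b := by
  classical
  let _ : GCDMonoid K[X] := EuclideanDomain.gcdMonoid K[X]
  have hg0 : gcd a b ≠ 0 := gcd_ne_zero_of_left ha
  have hcop := isCoprime_div_gcd_div_gcd_of_gcd_ne_zero hg0
  have hda := EuclideanDomain.mul_div_cancel' hg0 (gcd_dvd_left a b)
  have hdb := EuclideanDomain.mul_div_cancel' hg0 (gcd_dvd_right a b)
  set c := gcd a b
  set a' := a / c
  set b' := b / c
  have h' : a' ^ 2 * s = b' ^ 2 * t := by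
    refine mul_left_cancel₀ (pow_ne_zero 2 hg0) ?_
    rw [← hda, ← hdb] at h
    linear_combination h
  have hdvd : a' ^ 2 ∣ t := (hcop.pow (m := 2) (n := 2)).dvd_of_dvd_mul_left ⟨s, h'.symm⟩
  rw [← hda, ← hdb]
  exact mul_dvd_mul_left c (ht a' (by rwa [← pow_two])).dvd

/-- The number of polynomials of degree `n` that are `PowerFree e`. -/
def powerFreeCount (e : F[X] → ℕ) (n : ℕ) : ℕ :=
  {g : F[X] | g.natDegree = n ∧ PowerFree e g}.ncard

theorem ncard_degree_eq_sum_squarefree (n : ℕ) :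
    {g : F[X] | g.degree = n}.ncard = ∑ k ∈ Finset.range (n / 2 + 1),
      Fintype.card F ^ k * powerFreeCount (F := F) (fun _ => 1) (n - 2 * k) := by
  let f : (Σ k : Fin (n / 2 + 1), {d : F[X] // d.Monic ∧ d.natDegree = k} ×
      {g : F[X] | g.natDegree = n - 2 * k ∧ PowerFree (fun _ => 1) g}) →
      {g : F[X] | g.degree = n} := fun x => ⟨x.2.1.1 ^ 2 * x.2.2.1, by
    obtain ⟨k, ⟨d, hd, hdk⟩, ⟨s, hs, hs1⟩⟩ := x
    have hk := k.2
    simp only [Set.mem_ofPred_eq]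
    rw [degree_eq_iff_natDegree_eq (mul_ne_zero (pow_ne_zero 2 hd.ne_zero) hs1.ne_zero),
      natDegree_mul (pow_ne_zero 2 hd.ne_zero) hs1.ne_zero, natDegree_pow, hdk, hs]
    omega⟩
  have hf : Function.Bijective f := by
    constructor
    · rintro ⟨k, ⟨d, hd, hdk⟩, ⟨s, hs, hs1⟩⟩ ⟨l, ⟨c, hc, hcl⟩, ⟨t, ht, ht1⟩⟩ h
      replace h : d ^ 2 * s = c ^ 2 * t := congrArg Subtype.val h
      rw [powerFree_one_iff_squarefree] at hs1 ht1
      obtain rfl : d = c := eq_of_monic_of_associated hd hc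
        (associated_of_dvd_dvd (dvd_of_sq_mul_eq_sq_mul hd.ne_zero ht1 h)
          (dvd_of_sq_mul_eq_sq_mul hc.ne_zero hs1 h.symm))
      obtain rfl : s = t := mul_left_cancel₀ (pow_ne_zero 2 hd.ne_zero) h
      obtain rfl : k = l := Fin.ext (hdk.symm.trans hcl)
      rfl
    · rintro ⟨g, hg : g.degree = n⟩
      have hg0 : g ≠ 0 := by rintro rfl; simp at hg
      obtain ⟨d, s, hd, hs, rfl⟩ := exists_sq_mul_squarefree g hg0
      rw [degree_eq_iff_natDegree_eq hg0, natDegree_mul (pow_ne_zero 2 hd.ne_zero) hs.ne_zero,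
        natDegree_pow] at hg
      exact ⟨⟨⟨d.natDegree, by omega⟩, ⟨d, hd, rfl⟩,
        ⟨s, by dsimp only; omega, powerFree_one_iff_squarefree.2 hs⟩⟩, rfl⟩
  have : ∀ k, Finite {d : F[X] // d.Monic ∧ d.natDegree = k} := fun k =>
    ((finite_natDegree_le k).subset fun d hd => hd.2.le :
      {d : F[X] | d.Monic ∧ d.natDegree = k}.Finite)
  have : ∀ k, Finite {g : F[X] | g.natDegree = k ∧ PowerFree (fun _ => 1) g} := fun k =>
    (finite_natDegree_le k).subset fun d hd => hd.1.le
  rw [← Nat.card_coe_set_eq, ← Nat.card_congr (Equiv.ofBijective f hf), Nat.card_sigma,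
    Finset.sum_range]
  refine Finset.sum_congr rfl fun k _ => ?_
  rw [Nat.card_prod, card_monic_natDegree_eq, Nat.card_coe_set_eq, powerFreeCount]

theorem squarefreeCount_add (n : ℕ) :
    powerFreeCount (F := F) (fun _ => 1) (n + 2) +
      Fintype.card F * {g : F[X] | g.degree = n}.ncard =
      {g : F[X] | g.degree = (n + 2 : ℕ)}.ncard := by
  rw [ncard_degree_eq_sum_squarefree n, ncard_degree_eq_sum_squarefree (n + 2),
    show (n + 2) / 2 + 1 = (n / 2 + 1) + 1 by omega, Finset.mul_sum,
    Finset.sum_range_succ' _ (n / 2 + 1), add_comm]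
  congr 1
  · refine Finset.sum_congr rfl fun k _ => ?_
    rw [show n + 2 - 2 * (k + 1) = n - 2 * k by omega]
    ring
  · simp

theorem powerFree_update_iff {K : Type*} [Field K] [DecidableEq K[X]] {e : K[X] → ℕ} {p : K[X]}
    (hp : p.Monic) (hp' : Irreducible p) (k : ℕ) (g : K[X]) :
    PowerFree (Function.update e p k) g ↔ ¬ p ^ (k + 1) ∣ g ∧
      ∀ P : K[X], P.Monic → Irreducible P → P ≠ p → ¬ P ^ (e P + 1) ∣ g := by
  constructor
  · refine fun h => ⟨by simpa using h p hp hp', fun P hP hP' hne => ?_⟩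
    simpa [hne] using h P hP hP'
  · rintro ⟨h₁, h₂⟩ P hP hP'
    by_cases hne : P = p
    · subst hne
      simpa using h₁
    · simpa [hne] using h₂ P hP hP' hne

theorem powerFree_update_mul_iff {K : Type*} [Field K] [DecidableEq K[X]] {e : K[X] → ℕ}
    {p : K[X]} (hp : p.Monic) (hp' : Irreducible p) (k : ℕ) (g : K[X]) :
    PowerFree (Function.update e p (k + 1)) (p * g) ↔ PowerFree (Function.update e p k) g := by
  rw [powerFree_update_iff hp hp', powerFree_update_iff hp hp', pow_succ' p (k + 1),
    mul_dvd_mul_iff_left hp'.ne_zero]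
  refine and_congr_right fun _ => forall₄_congr fun P hP hP' hne => not_congr ?_
  have hcop : IsCoprime P p := hP'.coprime_iff_not_dvd.2 fun hd =>
    hne (eq_of_monic_of_associated hP hp (hP'.associated_of_dvd hp' hd))
  exact ⟨hcop.pow_left.dvd_of_dvd_mul_left, fun h => h.mul_left p⟩

theorem powerFreeCount_update_succ [DecidableEq F[X]] (e : F[X] → ℕ) {p : F[X]} (hp : p.Monic)
    (hdeg : p.natDegree = 1) (k n : ℕ) :
    powerFreeCount (Function.update e p (k + 1)) (n + 1) =
      powerFreeCount (Function.update e p 0) (n + 1) +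
        powerFreeCount (Function.update e p k) n := by
  have hp' : Irreducible p := irreducible_of_degree_eq_one
    ((degree_eq_iff_natDegree_eq hp.ne_zero).2 hdeg)
  have hset : {g : F[X] | g.natDegree = n + 1 ∧ PowerFree (Function.update e p (k + 1)) g} =
      {g : F[X] | g.natDegree = n + 1 ∧ PowerFree (Function.update e p 0) g} ∪
        (p * ·) '' {g : F[X] | g.natDegree = n ∧ PowerFree (Function.update e p k) g} := by
    ext g
    simp only [Set.mem_ofPred_eq, Set.mem_union, Set.mem_image]
    constructor
    · rintro ⟨hn, hg⟩
      by_cases hpg : p ∣ g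
      · obtain ⟨h, rfl⟩ := hpg
        refine Or.inr ⟨h, ⟨?_, (powerFree_update_mul_iff hp hp' k h).1 hg⟩, rfl⟩
        rw [natDegree_mul hp.ne_zero (right_ne_zero_of_mul hg.ne_zero)] at hn
        omega
      · rw [powerFree_update_iff hp hp'] at hg
        exact Or.inl ⟨hn, (powerFree_update_iff hp hp' _ _).2 ⟨by simpa using hpg, hg.2⟩⟩
    · rintro (⟨hn, hg⟩ | ⟨h, ⟨hn, hh⟩, rfl⟩)
      · rw [powerFree_update_iff hp hp'] at hg
        refine ⟨hn, (powerFree_update_iff hp hp' _ _).2 ⟨fun hd => hg.1 ?_, hg.2⟩⟩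
        exact (pow_dvd_pow p (by omega)).trans hd
      · refine ⟨?_, (powerFree_update_mul_iff hp hp' k h).2 hh⟩
        rw [natDegree_mul hp.ne_zero hh.ne_zero]
        omega
  have hdisj : Disjoint {g : F[X] | g.natDegree = n + 1 ∧ PowerFree (Function.update e p 0) g}
      ((p * ·) '' {g : F[X] | g.natDegree = n ∧ PowerFree (Function.update e p k) g}) := by
    rw [Set.disjoint_left]
    rintro _ ⟨_, hg⟩ ⟨h, _, rfl⟩
    exact ((powerFree_update_iff hp hp' _ _).1 hg).1 (by simp)
  rw [powerFreeCount, hset, Set.ncard_union_eq hdisj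
    ((finite_natDegree_le (n + 1)).subset fun g hg => hg.1.le)
    (((finite_natDegree_le n).subset fun g hg => hg.1.le).image _),
    Set.ncard_image_of_injective _ (mul_right_injective₀ hp.ne_zero), powerFreeCount,
    powerFreeCount]

theorem tendsto_of_tendsto_succ_add_mul {u : ℕ → ℝ} {c L : ℝ} (hc : |c| < 1)
    (h : Filter.Tendsto (fun n => u (n + 1) + c * u n) Filter.atTop (nhds L)) :
    Filter.Tendsto u Filter.atTop (nhds (L / (1 + c))) := by
  have hc1 : 1 + c ≠ 0 := by linarith [(abs_lt.1 hc).1]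
  rw [Metric.tendsto_atTop] at h ⊢
  intro ε hε
  obtain ⟨N, hN⟩ := h (ε / 2 * (1 - |c|)) (mul_pos (half_pos hε) (by linarith))
  set l := L / (1 + c) with hl
  have hL : L = (1 + c) * l := by rw [hl]; field_simp
  have hbound : ∀ k, |u (N + k) - l| ≤ ε / 2 + |c| ^ k * |u N - l| := by
    intro k
    induction k with
    | zero => simpa using (half_pos hε).le
    | succ k ih =>
      have h₁ := hN (N + k) (by omega)
      rw [Real.dist_eq] at h₁
      have h₂ : u (N + (k + 1)) - l =
          (u (N + k + 1) + c * u (N + k) - L) - c * (u (N + k) - l) := by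
        rw [hL, add_assoc N k 1]
        ring
      have h₃ := mul_le_mul_of_nonneg_left ih (abs_nonneg c)
      calc |u (N + (k + 1)) - l|
          ≤ |u (N + k + 1) + c * u (N + k) - L| + |c * (u (N + k) - l)| := by
            rw [h₂]; exact abs_sub _ _
        _ ≤ ε / 2 + |c| ^ (k + 1) * |u N - l| := by
            rw [abs_mul, pow_succ]
            linarith
  have hpow : Filter.Tendsto (fun k => |c| ^ k * |u N - l|) Filter.atTop (nhds 0) := by
    simpa using (tendsto_pow_atTop_nhds_zero_of_lt_one (abs_nonneg c) hc).mul_const |u N - l|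
  obtain ⟨M, hM⟩ := Filter.eventually_atTop.1 (hpow.eventually (gt_mem_nhds (half_pos hε)))
  refine ⟨N + M, fun n hn => ?_⟩
  obtain ⟨k, rfl⟩ : ∃ k, n = N + k := ⟨n - N, by omega⟩
  rw [Real.dist_eq]
  linarith [hbound k, hM k (by omega)]

theorem one_lt_card_real : (1 : ℝ) < Fintype.card F := by
  exact_mod_cast Fintype.one_lt_card

theorem tendsto_squarefreeCount : Filter.Tendsto
    (fun n => (powerFreeCount (F := F) (fun _ => 1) n : ℝ) / (Fintype.card F : ℝ) ^ n)
    Filter.atTop (nhds (((Fintype.card F : ℝ) - 1) * (1 - 1 / Fintype.card F))) := by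
  have hq := one_lt_card_real (F := F)
  refine (Filter.tendsto_add_atTop_iff_nat 2).1 (tendsto_const_nhds.congr fun n => ?_)
  have h := squarefreeCount_add (F := F) n
  have h₁ := ncard_degree_eq (F := F) n
  have h₂ := ncard_degree_eq (F := F) (n + 2)
  rify at h h₁ h₂
  rw [eq_div_iff (by positivity)]
  field_simp
  set q : ℝ := (Fintype.card F : ℝ)
  linear_combination q ^ 2 * h₁ - q * h₂ - q * h

theorem tendsto_powerFreeCount_update_two [DecidableEq F[X]] {e : F[X] → ℕ} {p : F[X]} {L : ℝ}
    (hp : p.Monic) (hdeg : p.natDegree = 1) (he : e p = 1)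
    (h : Filter.Tendsto (fun n => (powerFreeCount e n : ℝ) / (Fintype.card F : ℝ) ^ n)
      Filter.atTop (nhds L)) :
    Filter.Tendsto
      (fun n => (powerFreeCount (Function.update e p 2) n : ℝ) / (Fintype.card F : ℝ) ^ n)
      Filter.atTop (nhds (L / (1 + 1 / Fintype.card F) + 1 / Fintype.card F * L)) := by
  have hq := one_lt_card_real (F := F)
  set q : ℝ := (Fintype.card F : ℝ)
  have hq0 : 0 < q := by linarith
  have hself : Function.update e p 1 = e := Function.update_eq_self_iff.2 he.symm
  have hstep : ∀ a b n : ℕ, ((a + b : ℕ) : ℝ) / q ^ (n + 1) =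
      a / q ^ (n + 1) + 1 / q * (b / q ^ n) :=
    fun a b n => by
      push_cast
      field_simp
      ring
  have h₀ : Filter.Tendsto (fun n => (powerFreeCount (Function.update e p 0) n : ℝ) / q ^ n)
      Filter.atTop (nhds (L / (1 + 1 / q))) := by
    refine tendsto_of_tendsto_succ_add_mul ?_
      (((Filter.tendsto_add_atTop_iff_nat 1).2 h).congr fun n => ?_)
    · rw [abs_of_pos (by positivity), div_lt_one hq0]
      exact hq
    · have h₁ := powerFreeCount_update_succ e hp hdeg 0 n
      rw [zero_add, hself] at h₁
      rw [h₁, hstep]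
  refine (Filter.tendsto_add_atTop_iff_nat 1).1
    ((((Filter.tendsto_add_atTop_iff_nat 1).2 h₀).add (h.const_mul (1 / q))).congr fun n => ?_)
  have h₁ := powerFreeCount_update_succ e hp hdeg 1 n
  rw [hself] at h₁
  rw [h₁, hstep]

theorem powerFreeCount_congr {K : Type*} [Field K] {e e' : K[X] → ℕ}
    (h : ∀ P : K[X], P.Monic → e P = e' P) :
    powerFreeCount e = powerFreeCount e' := by
  funext n
  have : ∀ g, PowerFree e g ↔ PowerFree e' g := fun g =>
    forall₂_congr fun P hP => by rw [h P hP]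
  simp only [powerFreeCount, this]

theorem tendsto_powerFreeCount_chenExponent : Filter.Tendsto
    (fun n => (powerFreeCount (F := F) chenExponent n : ℝ) / (Fintype.card F : ℝ) ^ n)
    Filter.atTop (nhds (if Fintype.card F = 2 then (49 / 72 : ℝ)
      else ((Fintype.card F : ℝ) - 1) * (1 - 1 / Fintype.card F))) := by
  classical
  split_ifs with h2
  · have hne : (X + 1 : F[X]) ≠ X := by simp
    have hdeg : (X + 1 : F[X]).natDegree = 1 := by rw [← C_1, natDegree_X_add_C]
    have hmonic : (X + 1 : F[X]).Monic := by rw [← C_1]; exact monic_X_add_C 1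
    have h := tendsto_powerFreeCount_update_two hmonic hdeg (by simp [hne])
      (tendsto_powerFreeCount_update_two monic_X natDegree_X rfl (tendsto_squarefreeCount (F := F)))
    rw [powerFreeCount_congr (e' := Function.update (Function.update (fun _ => 1) X 2) (X + 1) 2)]
    · convert h using 2
      rw [h2]
      norm_num
    · intro P hP
      by_cases h₁ : P.natDegree = 1
      · obtain ⟨a, rfl⟩ : ∃ a, P = X + C a := ⟨_, hP.eq_X_add_C h₁⟩
        rcases eq_zero_or_eq_one_of_card_eq_two h2 a with rfl | rfl
        · simp [chenExponent, h2, hne.symm]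
        · simp [chenExponent, h2, hdeg]
      · have hX : P ≠ X := by rintro rfl; simp at h₁
        have hX1 : P ≠ X + 1 := by rintro rfl; exact h₁ hdeg
        simp [chenExponent, h₁, hX, hX1]
  · rw [powerFreeCount_congr (e' := fun _ => 1) fun P _ => by simp [chenExponent, h2]]
    exact tendsto_squarefreeCount

theorem card_natDegree_mem_eq_sum (Q : F[X] → Prop) (m : ℕ) :
    Nat.card {g : F[X] // 1 ≤ g.natDegree ∧ g.natDegree ≤ m ∧ Q g} =
      ∑ n ∈ Finset.range m, {g : F[X] | g.natDegree = n + 1 ∧ Q g}.ncard := by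
  induction m with
  | zero =>
    rw [Finset.range_zero, Finset.sum_empty, Nat.card_eq_zero]
    exact Or.inl ⟨fun g => by have := g.2; omega⟩
  | succ m ih =>
    have hset : {g : F[X] | 1 ≤ g.natDegree ∧ g.natDegree ≤ m + 1 ∧ Q g} =
        {g : F[X] | 1 ≤ g.natDegree ∧ g.natDegree ≤ m ∧ Q g} ∪
          {g : F[X] | g.natDegree = m + 1 ∧ Q g} := by
      ext g
      simp only [Set.mem_ofPred_eq, Set.mem_union]
      by_cases hQ : Q g
      · simp only [hQ, and_true]
        omega
      · simp [hQ]
    rw [Finset.sum_range_succ, ← ih]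
    change Nat.card {g : F[X] | 1 ≤ g.natDegree ∧ g.natDegree ≤ m + 1 ∧ Q g} =
      Nat.card {g : F[X] | 1 ≤ g.natDegree ∧ g.natDegree ≤ m ∧ Q g} + _
    rw [Nat.card_coe_set_eq, Nat.card_coe_set_eq, hset]
    refine Set.ncard_union_eq (Set.disjoint_left.2 ?_)
      ((finite_natDegree_le m).subset fun g hg => hg.2.1)
      ((finite_natDegree_le (m + 1)).subset fun g hg => hg.1.le)
    rintro g ⟨_, h₁, _⟩ ⟨h₂, _⟩
    omega

theorem ncard_natDegree_eq_succ (n : ℕ) :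
    {g : F[X] | g.natDegree = n + 1}.ncard + Fintype.card F ^ (n + 1) =
      Fintype.card F ^ (n + 2) := by
  rw [← ncard_degree_eq (n + 1)]
  congr 3
  ext g
  rw [degree_eq_iff_natDegree_eq_of_pos n.succ_pos]

theorem tendsto_geometric_average {q L : ℝ} (hq : 1 < q) {c : ℕ → ℝ}
    (h : Filter.Tendsto (fun n => c n / q ^ n) Filter.atTop (nhds L)) :
    Filter.Tendsto (fun m => (∑ n ∈ Finset.range m, c (n + 1)) / q ^ m) Filter.atTop
      (nhds (L / (1 - 1 / q))) := by
  have hq0 : 0 < q := by linarith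
  rw [sub_eq_add_neg]
  refine tendsto_of_tendsto_succ_add_mul ?_
    (((Filter.tendsto_add_atTop_iff_nat 1).2 h).congr fun n => ?_)
  · rw [abs_neg, abs_of_pos (by positivity), div_lt_one hq0]
    exact hq
  · rw [Finset.sum_range_succ]
    field_simp
    ring

theorem card_natDegree_mem (m : ℕ) :
    Nat.card {g : F[X] // 1 ≤ g.natDegree ∧ g.natDegree ≤ m} + Fintype.card F =
      Fintype.card F ^ (m + 1) := by
  have h := card_natDegree_mem_eq_sum (F := F) (fun _ => True) m
  simp only [and_true] at h
  rw [h]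
  clear h
  induction m with
  | zero => simp
  | succ m ih =>
    rw [Finset.sum_range_succ, ← ncard_natDegree_eq_succ, ← ih]
    ring

/-- Theorem: density of Chen pairs `(g,g)`.
The natural density
`ρ = lim_{m→∞} #{g : 1 ≤ deg g ≤ m, (g,g) Chen pair} / #{g : 1 ≤ deg g ≤ m}`
exists and equals `49/72` if `q = 2` and `(q-1)/q` if `q > 2`. -/
theorem density_chenPair_self :
    Filter.Tendsto
      (fun m : ℕ =>
        (Nat.card {g : Polynomial F // 1 ≤ g.natDegree ∧ g.natDegree ≤ m ∧ IsChenPair g g} : ℝ) /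
        (Nat.card {g : Polynomial F // 1 ≤ g.natDegree ∧ g.natDegree ≤ m} : ℝ))
      Filter.atTop
      (nhds (if Fintype.card F = 2 then (49 / 72 : ℝ)
        else ((Fintype.card F : ℝ) - 1) / (Fintype.card F : ℝ))) := by
  have hq := one_lt_card_real (F := F)
  have hnum : ∀ m : ℕ,
      (Nat.card {g : F[X] // 1 ≤ g.natDegree ∧ g.natDegree ≤ m ∧ IsChenPair g g} : ℝ) =
        ∑ n ∈ Finset.range m, (powerFreeCount (F := F) chenExponent (n + 1) : ℝ) := fun m => by
    rw [card_natDegree_mem_eq_sum, Nat.cast_sum]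
    refine Finset.sum_congr rfl fun n _ => ?_
    rw [powerFreeCount]
    congr 2
    ext g
    refine and_congr_right fun hg => isChenPair_self_iff_powerFree ?_
    rintro rfl
    simp at hg
  have hden : ∀ m : ℕ, (Nat.card {g : F[X] // 1 ≤ g.natDegree ∧ g.natDegree ≤ m} : ℝ) =
      (Fintype.card F : ℝ) ^ (m + 1) - Fintype.card F := fun m => by
    rw [eq_sub_iff_add_eq]
    exact_mod_cast card_natDegree_mem (F := F) m
  have hlim := tendsto_geometric_average hq (tendsto_powerFreeCount_chenExponent (F := F))
  have hpow : Filter.Tendsto (fun m : ℕ => (Fintype.card F : ℝ) -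
      Fintype.card F * ((Fintype.card F : ℝ)⁻¹) ^ m) Filter.atTop (nhds (Fintype.card F : ℝ)) := by
    simpa using ((tendsto_pow_atTop_nhds_zero_of_lt_one (by positivity)
      (inv_lt_one_of_one_lt₀ hq)).const_mul (Fintype.card F : ℝ)).const_sub (Fintype.card F : ℝ)
  have hq0 : (Fintype.card F : ℝ) ≠ 0 := by positivity
  convert (hlim.div hpow hq0).congr fun m => ?_ using 2
  · split_ifs with h2
    · rw [h2]
      norm_num
    · have : (Fintype.card F : ℝ) - 1 ≠ 0 := by linarith
      field_simp
  · rw [hnum, hden, Pi.div_apply, div_div]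
    congr 1
    rw [mul_sub, pow_succ, mul_left_comm, ← mul_pow, mul_inv_cancel₀ hq0, one_pow, mul_one]
end
end

section
/- Let f, g ∈ A be non-constant with g = α P₁^{e₁} ⋯ P_r^{e_r} (α ∈ F_q*, P_i monic irreducible distinct, e_i ≥ 1), let σ : A_f → A_g be a function, and for 1 ≤ i ≤ r let σ_i : A_f → A_{P_i^{e_i}} be obtained by reducing the values of σ modulo P_i^{e_i}. Then σ is a polynomial function if and only if σ_i is a polynomial function for each 1 ≤ i ≤ r. -/
open Polynomial

noncomputable section

variable {F : Type*} [Field F] [Fintype F]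

/-- Pairwise coprime moduli admit elements that are `1` modulo one of them and `0` modulo
all the others. -/
theorem exists_dvd_sub_single {R ι : Type*} [CommRing R] [Finite ι] [DecidableEq ι] (Q : ι → R)
    (hQ : Pairwise fun i j => IsCoprime (Q i) (Q j)) (i : ι) :
    ∃ u : R, ∀ j, Q j ∣ u - (Pi.single i 1 : ι → R) j := by
  obtain ⟨u, hu⟩ := Ideal.exists_forall_sub_mem_ideal (I := fun j => Ideal.span {Q j})
    (fun j k hjk => (Ideal.isCoprime_span_singleton_iff _ _).mpr (hQ hjk))
    (Pi.single i 1)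
  exact ⟨u, fun j => Ideal.mem_span_singleton.mp (hu j)⟩

/-- Lemma, part (2): with `g = α · P₁^{e₁} ⋯ P_r^{e_r}` and `σ_i`
the reduction of `σ` modulo `P_i^{e_i}` (expressed via representatives),
`σ` is a polynomial function iff each `σ_i` is. -/
theorem polyFun_iff_components (f g : Polynomial F)
    (hf : 1 ≤ f.natDegree) (hg' : 1 ≤ g.natDegree)
    (r : ℕ) (α : F) (hα : α ≠ 0) (P : Fin r → Polynomial F) (e : Fin r → ℕ)
    (hPmonic : ∀ i, (P i).Monic) (hPirr : ∀ i, Irreducible (P i))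
    (hPdist : ∀ i j, i ≠ j → P i ≠ P j) (he : ∀ i, 1 ≤ e i)
    (hg : g = Polynomial.C α * ∏ i, P i ^ e i)
    (σ : (Polynomial F ⧸ Ideal.span {f}) → Polynomial F ⧸ Ideal.span {g})
    (σi : (i : Fin r) →
      (Polynomial F ⧸ Ideal.span {f}) → Polynomial F ⧸ Ideal.span {P i ^ e i})
    (hσi : ∀ i, ∀ h s : Polynomial F,
      Ideal.Quotient.mk (Ideal.span {g}) s = σ (Ideal.Quotient.mk (Ideal.span {f}) h) →
      σi i (Ideal.Quotient.mk (Ideal.span {f}) h)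
        = Ideal.Quotient.mk (Ideal.span {P i ^ e i}) s) :
    IsPolyFun f g σ ↔ ∀ i, IsPolyFun f (P i ^ e i) (σi i) := by
  have hcop : Pairwise fun i j => IsCoprime (P i ^ e i) (P j ^ e j) := by
    intro i j hij
    refine IsCoprime.pow (((hPirr i).coprime_iff_not_dvd).mpr fun hd => hPdist i j hij ?_)
    exact eq_of_monic_of_associated (hPmonic i) (hPmonic j)
      ((hPirr i).associated_of_dvd (hPirr j) hd)
  constructor
  · rintro ⟨G, hG⟩ i
    exact ⟨G, fun h hh => hσi i h _ (hG h hh).symm⟩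
  · intro H
    choose G hG using H
    choose u hu using exists_dvd_sub_single (fun i => P i ^ e i) hcop
    refine ⟨∑ i, C (u i) * G i, fun h hh => ?_⟩
    obtain ⟨s, hs⟩ := Ideal.Quotient.mk_surjective (σ (Ideal.Quotient.mk (Ideal.span {f}) h))
    rw [← hs, Ideal.Quotient.eq, Ideal.mem_span_singleton, hg,
      (isUnit_C.mpr (isUnit_iff_ne_zero.mpr hα)).mul_left_dvd]
    refine Finset.prod_dvd_of_coprime (fun i _ j _ hij => hcop hij) fun j _ => ?_
    have hsj : P j ^ e j ∣ s - (G j).eval h := by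
      rw [← Ideal.mem_span_singleton, ← Ideal.Quotient.eq, ← hσi j h s hs, hG j h hh]
    have hsum : P j ^ e j ∣ ∑ i, (u i - (Pi.single i 1 : Fin r → F[X]) j) * (G i).eval h :=
      Finset.dvd_sum fun i _ => (hu i j).mul_right _
    have hval : ∑ i, (u i - (Pi.single i 1 : Fin r → F[X]) j) * (G i).eval h
        = (∑ i, C (u i) * G i).eval h - (G j).eval h := by
      simp [sub_mul, Finset.sum_sub_distrib, eval_finsetSum, Pi.single_apply]
    rw [hval] at hsum
    simpa using dvd_sub hsj hsum
end
end

section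
/- Let f, g ∈ A be non-constant with g = α P₁^{e₁} ⋯ P_r^{e_r} (α ∈ F_q*, P_i monic irreducible distinct, e_i ≥ 1). Then (f, g) is a Chen pair if and only if (f, P_i^{e_i}) is a Chen pair for each 1 ≤ i ≤ r. -/
open Polynomial

noncomputable section

variable {F : Type*} [Field F] [Fintype F]

theorem mk_span_singleton_eq_iff_dvd_sub {R : Type*} [CommRing R] (g a b : R) :
    Ideal.Quotient.mk (Ideal.span {g}) a = Ideal.Quotient.mk (Ideal.span {g}) b ↔ g ∣ a - b := by
  rw [Ideal.Quotient.mk_eq_mk_iff_sub_mem, Ideal.mem_span_singleton]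

theorem exists_dvd_and_dvd_one_sub_of_pairwise_isCoprime {R ι : Type*} [CommRing R] [Fintype ι]
    [DecidableEq ι] {p : ι → R} (hp : Pairwise fun i j => IsCoprime (p i) (p j)) (i : ι) :
    ∃ c : R, p i ∣ 1 - c ∧ ∏ j ∈ Finset.univ.erase i, p j ∣ c := by
  have hco : IsCoprime (p i) (∏ j ∈ Finset.univ.erase i, p j) :=
    IsCoprime.prod_right fun j hj => hp (Finset.ne_of_mem_erase hj).symm
  obtain ⟨u, v, huv⟩ := hco
  exact ⟨v * ∏ j ∈ Finset.univ.erase i, p j, ⟨u, by linear_combination -huv⟩,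
    dvd_mul_left _ _⟩

/-- If `p * m` is associated to the modulus `g`, where `c ≡ 1 (mod p)` and `m ∣ c`, then the Chen
property passes from `(f, g)` to `(f, p)`. -/
theorem IsChenPair.of_mul {f g p m c : Polynomial F} (hg : Associated g (p * m))
    (hcp : p ∣ 1 - c) (hcm : m ∣ c) (H : IsChenPair f g) : IsChenPair f p := by
  intro σ hσ
  choose s hs using fun x : Polynomial F ⧸ Ideal.span {f} =>
    Ideal.Quotient.mk_surjective (σ x)
  obtain ⟨G, hG⟩ := H (fun x => Ideal.Quotient.mk _ (c * s x)) (by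
    intro h₁ h₂ h hd₁ hd₂ hhg hh s₁ s₂ e₁ e₂
    rw [mk_span_singleton_eq_iff_dvd_sub] at e₁ e₂
    obtain ⟨a, b, ha, hb, rfl⟩ := exists_dvd_and_dvd_of_dvd_mul (hhg.trans hg.dvd)
    have key := mul_dvd_mul (hσ h₁ h₂ a hd₁ hd₂ ha ((dvd_mul_right a b).trans hh) _ _
      (hs _) (hs _)) (hb.trans hcm)
    have := (((hhg.trans e₁).sub (hhg.trans e₂)).add key)
    convert this using 1
    ring)
  refine ⟨G, fun h hd => ?_⟩
  have hgh := hG h hd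
  rw [mk_span_singleton_eq_iff_dvd_sub] at hgh
  rw [← hs, mk_span_singleton_eq_iff_dvd_sub]
  have := (((dvd_mul_right p m).trans hg.symm.dvd).trans hgh).add
    (hcp.mul_right (s (Ideal.Quotient.mk _ h)))
  convert this using 1
  ring

/-- If the modulus `g` is associated to a product of pairwise coprime factors, each of which forms
a Chen pair with `f`, then `(f, g)` is a Chen pair. -/
theorem IsChenPair.of_forall {ι : Type*} [Fintype ι] [DecidableEq ι] {f g : Polynomial F}
    {p : ι → Polynomial F} (hp : Pairwise fun i j => IsCoprime (p i) (p j))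
    (hg : Associated g (∏ i, p i)) (H : ∀ i, IsChenPair f (p i)) : IsChenPair f g := by
  intro σ hσ
  have hpg : ∀ i, p i ∣ g := fun i =>
    (Finset.dvd_prod_of_mem p (Finset.mem_univ i)).trans hg.symm.dvd
  choose s hs using fun x : Polynomial F ⧸ Ideal.span {f} =>
    Ideal.Quotient.mk_surjective (σ x)
  have hpoly : ∀ i, IsPolyFun f (p i) (fun x => Ideal.Quotient.mk _ (s x)) := by
    refine fun i => H i _ ?_
    intro h₁ h₂ h hd₁ hd₂ hhp hh s₁ s₂ e₁ e₂
    rw [mk_span_singleton_eq_iff_dvd_sub] at e₁ e₂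
    have key := hσ h₁ h₂ h hd₁ hd₂ (hhp.trans (hpg i)) hh _ _ (hs _) (hs _)
    have := (((hhp.trans e₁).sub (hhp.trans e₂)).add key)
    convert this using 1
    ring
  choose G hG using hpoly
  choose c hc hcm using exists_dvd_and_dvd_one_sub_of_pairwise_isCoprime hp
  refine ⟨∑ i, C (c i) * G i, fun h hd => ?_⟩
  rw [← hs, mk_span_singleton_eq_iff_dvd_sub]
  refine hg.dvd.trans (Fintype.prod_dvd_of_coprime hp fun i => ?_)
  have hGi := hG i h hd
  rw [mk_span_singleton_eq_iff_dvd_sub] at hGi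
  have hrest : p i ∣ ∑ j ∈ Finset.univ.erase i, c j * (G j).eval h := by
    refine Finset.dvd_sum fun j hj => Dvd.dvd.mul_right ?_ _
    exact (Finset.dvd_prod_of_mem p (Finset.mem_erase.2
      ⟨(Finset.ne_of_mem_erase hj).symm, Finset.mem_univ i⟩)).trans (hcm j)
  have hsum : (∑ j, C (c j) * G j).eval h =
      c i * (G i).eval h + ∑ j ∈ Finset.univ.erase i, c j * (G j).eval h := by
    rw [Finset.add_sum_erase _ (fun j => c j * (G j).eval h) (Finset.mem_univ i)]
    simp [eval_finsetSum]
  have := (hGi.add ((hc i).mul_right ((G i).eval h))).sub hrest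
  rw [hsum]
  convert this using 1
  ring

/-- Lemma, part (3): with `g = α · P₁^{e₁} ⋯ P_r^{e_r}`,
`(f, g)` is a Chen pair iff `(f, P_i^{e_i})` is a Chen pair for each `i`. -/
theorem chenPair_iff_components (f g : Polynomial F)
    (hf : 1 ≤ f.natDegree) (hg' : 1 ≤ g.natDegree)
    (r : ℕ) (α : F) (hα : α ≠ 0) (P : Fin r → Polynomial F) (e : Fin r → ℕ)
    (hPmonic : ∀ i, (P i).Monic) (hPirr : ∀ i, Irreducible (P i))
    (hPdist : ∀ i j, i ≠ j → P i ≠ P j) (he : ∀ i, 1 ≤ e i)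
    (hg : g = Polynomial.C α * ∏ i, P i ^ e i) :
    IsChenPair f g ↔ ∀ i, IsChenPair f (P i ^ e i) := by
  have hp : Pairwise fun i j => IsCoprime (P i ^ e i) (P j ^ e j) := fun i j hij =>
    ((hPirr i).coprime_iff_not_dvd.2 fun hd => hPdist i j hij
      (eq_of_monic_of_associated (hPmonic i) (hPmonic j)
        ((hPirr i).associated_of_dvd (hPirr j) hd))).pow
  have hassoc : Associated g (∏ i, P i ^ e i) := by
    rw [hg]
    exact associated_unit_mul_left _ _ (isUnit_C.2 hα.isUnit)
  refine ⟨fun H i => ?_, IsChenPair.of_forall hp hassoc⟩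
  obtain ⟨c, hc, hcm⟩ := exists_dvd_and_dvd_one_sub_of_pairwise_isCoprime hp i
  refine H.of_mul ?_ hc hcm
  rwa [Finset.mul_prod_erase _ (fun j => P j ^ e j) (Finset.mem_univ i)]
end
end

section
/- Let f ∈ A be non-constant with n = deg f, P ∈ A monic irreducible of degree d, and e ≥ 1. Then the number M(f, P^e) of congruence preserving functions from A_f to A_{P^e} equals |P|^{e q^n − (q−1) Σ_{k=1}^{n−1} q^k · min{e, ⌊k/d⌋}}, i.e. q^{d(e q^n − (q−1) Σ_{k=1}^{n−1} q^k min{e, ⌊k/d⌋})}. -/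
open Polynomial

noncomputable section

variable {F : Type*} [Field F] [Fintype F]

/-- `σ` respects congruences modulo the powers `P ^ j`, `j ≤ e`, where the points of `X` are
compared through `r : X → K[X]`. -/
def IsPowCongPres {K X : Type*} [Field K] (P : Polynomial K) (r : X → Polynomial K)
    (e : ℕ) (σ : X → Polynomial K ⧸ Ideal.span {P ^ e}) : Prop :=
  ∀ j ≤ e, ∀ x y, P ^ j ∣ r x - r y → P ^ j ∣ (σ x).out - (σ y).out

theorem mk_span_eq_iff_dvd {K : Type*} [Field K] (g a b : Polynomial K) :
    Ideal.Quotient.mk (Ideal.span {g}) a = Ideal.Quotient.mk (Ideal.span {g}) b ↔ g ∣ a - b := by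
  rw [Ideal.Quotient.eq, Ideal.mem_span_singleton]

theorem mk_span_out {K : Type*} [Field K] (g : Polynomial K)
    (x : Polynomial K ⧸ Ideal.span {g}) : Ideal.Quotient.mk (Ideal.span {g}) x.out = x :=
  Quotient.out_eq' x

theorem dvd_out_mk_sub {K : Type*} [Field K] (g a : Polynomial K) :
    g ∣ (Ideal.Quotient.mk (Ideal.span {g}) a).out - a := by
  rw [← mk_span_eq_iff_dvd, mk_span_out]

theorem finite_quotient_span_s10 {K : Type*} [Field K] [Finite K] {g : Polynomial K} (hg : g ≠ 0) :
    Finite (Polynomial K ⧸ Ideal.span {g}) := by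
  have : Module.Finite K (AdjoinRoot g) := (AdjoinRoot.powerBasis hg).finite
  exact (Module.finite_of_finite K : Finite (AdjoinRoot g))

theorem natCard_quotient_span_s10 {K : Type*} [Field K] [Finite K] {g : Polynomial K} (hg : g ≠ 0) :
    Nat.card (Polynomial K ⧸ Ideal.span {g}) = Nat.card K ^ g.natDegree := by
  have : Module.Finite K (AdjoinRoot g) := (AdjoinRoot.powerBasis hg).finite
  have h : Nat.card (AdjoinRoot g) = Nat.card K ^ Module.finrank K (AdjoinRoot g) :=
    Module.natCard_eq_pow_finrank
  rw [(AdjoinRoot.powerBasis hg).finrank, AdjoinRoot.powerBasis_dim] at h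
  exact h

/-- The lift of `τ`, a function modulo `P ^ e`, to a function modulo `P ^ (e + 1)` whose
next `P`-adic digit is `c`. -/
def powLift {K X : Type*} [Field K] (P : Polynomial K) (r : X → Polynomial K) (e : ℕ)
    (τ : X → Polynomial K ⧸ Ideal.span {P ^ e})
    (c : Set.range (fun x => Ideal.Quotient.mk (Ideal.span {P ^ (e + 1)}) (r x)) →
      Polynomial K ⧸ Ideal.span {P}) (x : X) : Polynomial K ⧸ Ideal.span {P ^ (e + 1)} :=
  Ideal.Quotient.mk _ ((τ x).out + P ^ e * (c ⟨_, x, rfl⟩).out)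

theorem dvd_out_powLift_sub {K X : Type*} [Field K] (P : Polynomial K) (r : X → Polynomial K)
    (e : ℕ) (τ : X → Polynomial K ⧸ Ideal.span {P ^ e})
    (c : Set.range (fun x => Ideal.Quotient.mk (Ideal.span {P ^ (e + 1)}) (r x)) →
      Polynomial K ⧸ Ideal.span {P}) (x : X) :
    P ^ (e + 1) ∣ (powLift P r e τ c x).out - ((τ x).out + P ^ e * (c ⟨_, x, rfl⟩).out) :=
  dvd_out_mk_sub _ _

theorem IsPowCongPres.powLift {K X : Type*} [Field K] {P : Polynomial K}
    {r : X → Polynomial K} {e : ℕ} {τ : X → Polynomial K ⧸ Ideal.span {P ^ e}}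
    (hτ : IsPowCongPres P r e τ)
    (c : Set.range (fun x => Ideal.Quotient.mk (Ideal.span {P ^ (e + 1)}) (r x)) →
      Polynomial K ⧸ Ideal.span {P}) : IsPowCongPres P r (e + 1) (powLift P r e τ c) := by
  intro j hj x y hxy
  have hx := (pow_dvd_pow P hj).trans (dvd_out_powLift_sub P r e τ c x)
  have hy := (pow_dvd_pow P hj).trans (dvd_out_powLift_sub P r e τ c y)
  suffices h : P ^ j ∣ ((τ x).out + P ^ e * (c ⟨_, x, rfl⟩).out) -
      ((τ y).out + P ^ e * (c ⟨_, y, rfl⟩).out) by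
    have := dvd_add (dvd_sub hx hy) h
    ring_nf at this ⊢
    exact this
  rcases Nat.lt_or_ge e j with h | h
  · obtain rfl : j = e + 1 := by omega
    have h1 : τ x = τ y := by
      have := hτ e le_rfl x y ((pow_dvd_pow P (Nat.le_succ e)).trans hxy)
      rwa [← mk_span_eq_iff_dvd, mk_span_out, mk_span_out] at this
    have h2 : (⟨_, x, rfl⟩ : Set.range (fun x =>
        Ideal.Quotient.mk (Ideal.span {P ^ (e + 1)}) (r x))) = ⟨_, y, rfl⟩ :=
      Subtype.ext ((mk_span_eq_iff_dvd _ _ _).2 hxy)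
    rw [h1, h2, sub_self]
    exact dvd_zero _
  · have h1 := hτ j h x y hxy
    have h2 : P ^ j ∣ P ^ e * ((c ⟨_, x, rfl⟩).out - (c ⟨_, y, rfl⟩).out) :=
      (pow_dvd_pow P h).mul_right _
    have := dvd_add h1 h2
    ring_nf at this ⊢
    exact this

theorem powLift_bijective {K X : Type*} [Field K] {P : Polynomial K} (hP : P ≠ 0)
    (r : X → Polynomial K) (e : ℕ) : Function.Bijective
      (fun p : {τ : X → Polynomial K ⧸ Ideal.span {P ^ e} // IsPowCongPres P r e τ} ×
          (Set.range (fun x => Ideal.Quotient.mk (Ideal.span {P ^ (e + 1)}) (r x)) →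
            Polynomial K ⧸ Ideal.span {P}) =>
        (⟨powLift P r e p.1.1 p.2, p.1.2.powLift p.2⟩ :
          {σ : X → Polynomial K ⧸ Ideal.span {P ^ (e + 1)} // IsPowCongPres P r (e + 1) σ})) := by
  have hPe : P ^ e ≠ 0 := pow_ne_zero e hP
  constructor
  · rintro ⟨⟨τ, hτ⟩, c⟩ ⟨⟨τ', hτ'⟩, c'⟩ h
    have h0 : ∀ x, P ^ (e + 1) ∣ ((τ x).out + P ^ e * (c ⟨_, x, rfl⟩).out) -
        ((τ' x).out + P ^ e * (c' ⟨_, x, rfl⟩).out) := fun x =>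
      (mk_span_eq_iff_dvd _ _ _).1 (congrFun (congrArg Subtype.val h) x)
    obtain rfl : τ = τ' := by
      funext x
      rw [← mk_span_out _ (τ x), ← mk_span_out _ (τ' x), mk_span_eq_iff_dvd]
      have h1 := (pow_dvd_pow P (Nat.le_succ e)).trans (h0 x)
      have h2 := dvd_sub h1 (dvd_mul_right (P ^ e) ((c ⟨_, x, rfl⟩).out - (c' ⟨_, x, rfl⟩).out))
      ring_nf at h2 ⊢
      exact h2
    obtain rfl : c = c' := by
      funext ⟨_, x, rfl⟩
      rw [← mk_span_out _ (c _), ← mk_span_out _ (c' _), mk_span_eq_iff_dvd]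
      have h1 := h0 x
      rw [add_sub_add_left_eq_sub, ← mul_sub] at h1
      exact (mul_dvd_mul_iff_left hPe).1 ((pow_succ P e).symm.dvd.trans h1)
    rfl
  · rintro ⟨σ, hσ⟩
    let τ : X → Polynomial K ⧸ Ideal.span {P ^ e} := fun x => Ideal.Quotient.mk _ (σ x).out
    have hτd : ∀ x, P ^ e ∣ (σ x).out - (τ x).out := fun x =>
      (dvd_sub_comm).1 (dvd_out_mk_sub _ _)
    have hτ : IsPowCongPres P r e τ := by
      intro j hj x y hxy
      have h1 := hσ j (hj.trans (Nat.le_succ e)) x y hxy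
      have h2 := (pow_dvd_pow P hj).trans (hτd x)
      have h3 := (pow_dvd_pow P hj).trans (hτd y)
      have := dvd_add (dvd_sub h1 h2) h3
      ring_nf at this ⊢
      exact this
    choose u hu using hτd
    refine ⟨⟨⟨τ, hτ⟩, fun z => Ideal.Quotient.mk _ (u z.2.choose)⟩,
      Subtype.ext (funext fun x => ?_)⟩
    set z : Set.range (fun x => Ideal.Quotient.mk (Ideal.span {P ^ (e + 1)}) (r x)) :=
      ⟨_, x, rfl⟩
    have hy : P ^ (e + 1) ∣ r z.2.choose - r x :=
      (mk_span_eq_iff_dvd _ _ _).1 z.2.choose_spec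
    change Ideal.Quotient.mk _
      ((τ x).out + P ^ e * (Ideal.Quotient.mk (Ideal.span {P}) (u z.2.choose)).out) = σ x
    generalize z.2.choose = y at hy ⊢
    have h1 : σ y = σ x := by
      have := hσ (e + 1) le_rfl y x hy
      rwa [← mk_span_eq_iff_dvd, mk_span_out, mk_span_out] at this
    have h2 : u y = u x := by
      apply mul_left_cancel₀ hPe
      rw [← hu, ← hu]
      simp only [τ, h1]
    rw [h2, ← mk_span_out _ (σ x), mk_span_eq_iff_dvd]
    have h3 := mul_dvd_mul_left (P ^ e) (dvd_out_mk_sub P (u x))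
    rw [mul_sub, ← hu, ← pow_succ] at h3
    ring_nf at h3 ⊢
    exact h3

theorem natCard_isPowCongPres {X : Type*} [Finite X] {P : Polynomial F} (hP : P ≠ 0)
    (r : X → Polynomial F) (e : ℕ) :
    Nat.card {σ : X → Polynomial F ⧸ Ideal.span {P ^ e} // IsPowCongPres P r e σ} =
      Fintype.card F ^ (P.natDegree * ∑ i ∈ Finset.range e,
        Nat.card (Set.range fun x => Ideal.Quotient.mk (Ideal.span {P ^ (i + 1)}) (r x))) := by
  induction e with
  | zero =>
    have : Subsingleton (Polynomial F ⧸ Ideal.span {P ^ 0}) := by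
      rw [Ideal.Quotient.subsingleton_iff]; simp
    have : Nonempty {σ : X → Polynomial F ⧸ Ideal.span {P ^ 0} // IsPowCongPres P r 0 σ} :=
      ⟨⟨fun _ => 0, fun _ _ _ _ _ => by simp⟩⟩
    simp
  | succ e ih =>
    have := finite_quotient_span_s10 hP
    rw [← Nat.card_congr (Equiv.ofBijective _ (powLift_bijective hP r e)), Nat.card_prod, ih,
      Nat.card_fun, natCard_quotient_span_s10 hP, Nat.card_eq_fintype_card (α := F), ← pow_mul,
      ← pow_add, Finset.sum_range_succ, mul_add]

/-- The representative of degree `< deg f` of a class modulo `f`. -/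
def modRep {K : Type*} [Field K] (f : Polynomial K) (x : Polynomial K ⧸ Ideal.span {f}) :
    Polynomial K :=
  x.out % f

theorem mk_modRep {K : Type*} [Field K] (f : Polynomial K) (x : Polynomial K ⧸ Ideal.span {f}) :
    Ideal.Quotient.mk (Ideal.span {f}) (modRep f x) = x := by
  conv_rhs => rw [← mk_span_out f x]
  rw [mk_span_eq_iff_dvd, dvd_sub_comm, modRep]
  exact ⟨x.out / f, sub_eq_of_eq_add (EuclideanDomain.div_add_mod _ _).symm⟩

theorem degree_modRep_lt {K : Type*} [Field K] {f : Polynomial K} (hf : f ≠ 0)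
    (x : Polynomial K ⧸ Ideal.span {f}) : (modRep f x).degree < f.degree :=
  EuclideanDomain.mod_lt _ hf

theorem eq_of_dvd_sub_of_degree_lt {K : Type*} [Field K] {g a b : Polynomial K}
    (ha : a.degree < g.degree) (hb : b.degree < g.degree) (h : g ∣ a - b) : a = b := by
  rw [← sub_eq_zero]
  exact eq_zero_of_dvd_of_degree_lt h ((degree_sub_le _ _).trans_lt (max_lt ha hb))

theorem modRep_mk {K : Type*} [Field K] {f h : Polynomial K} (hh : h.degree < f.degree) :
    modRep f (Ideal.Quotient.mk _ h) = h := by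
  have hf : f ≠ 0 := by rintro rfl; simp at hh
  refine eq_of_dvd_sub_of_degree_lt (degree_modRep_lt hf _) hh ?_
  rw [← mk_span_eq_iff_dvd, mk_modRep]

theorem isCongPres_iff_isPowCongPres {K : Type*} [Field K] {f P : Polynomial K} (hf : f ≠ 0)
    (hP : Irreducible P) (e : ℕ)
    (σ : (Polynomial K ⧸ Ideal.span {f}) → Polynomial K ⧸ Ideal.span {P ^ e}) :
    IsCongPres f (P ^ e) σ ↔ IsPowCongPres P (modRep f) e σ := by
  constructor
  · intro h j hj x y hxy
    refine h _ _ _ (degree_modRep_lt hf x) (degree_modRep_lt hf y) (pow_dvd_pow P hj) hxy _ _ ?_ ?_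
      <;> rw [mk_span_out, mk_modRep]
  · intro H h₁ h₂ h hh₁ hh₂ hdvd hcong s₁ s₂ hs₁ hs₂
    obtain ⟨j, hj, hass⟩ := (dvd_prime_pow hP.prime e).1 hdvd
    have h1 := H j hj (Ideal.Quotient.mk _ h₁) (Ideal.Quotient.mk _ h₂)
    rw [modRep_mk hh₁, modRep_mk hh₂, ← hs₁, ← hs₂] at h1
    have h2 := h1 (hass.dvd_iff_dvd_left.1 hcong)
    have h3 := (pow_dvd_pow P hj).trans (dvd_out_mk_sub (P ^ e) s₁)
    have h4 := (pow_dvd_pow P hj).trans (dvd_out_mk_sub (P ^ e) s₂)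
    rw [hass.dvd_iff_dvd_left]
    have := dvd_add (dvd_sub h2 h3) h4
    ring_nf at this ⊢
    exact this

theorem natCard_range_mk_modRep {f g : Polynomial F} (hf : f ≠ 0) (hg : g ≠ 0) :
    Nat.card (Set.range fun x => Ideal.Quotient.mk (Ideal.span {g}) (modRep f x)) =
      Fintype.card F ^ min f.natDegree g.natDegree := by
  rcases le_total f.natDegree g.natDegree with h | h
  · rw [min_eq_left h, Nat.card_range_of_injective, natCard_quotient_span_s10 hf,
      Nat.card_eq_fintype_card]
    intro x y hxy
    have hdeg : f.degree ≤ g.degree := by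
      rw [degree_eq_natDegree hf, degree_eq_natDegree hg]; exact_mod_cast h
    rw [← mk_modRep f x, ← mk_modRep f y,
      eq_of_dvd_sub_of_degree_lt ((degree_modRep_lt hf x).trans_le hdeg)
        ((degree_modRep_lt hf y).trans_le hdeg) ((mk_span_eq_iff_dvd _ _ _).1 hxy)]
  · have hsurj : Function.Surjective
        fun x => Ideal.Quotient.mk (Ideal.span {g}) (modRep f x) := by
      intro y
      have hdeg : g.degree ≤ f.degree := by
        rw [degree_eq_natDegree hf, degree_eq_natDegree hg]; exact_mod_cast h
      refine ⟨Ideal.Quotient.mk _ (modRep g y), ?_⟩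
      simp only [modRep_mk ((degree_modRep_lt hg y).trans_le hdeg), mk_modRep]
    rw [min_eq_right h, hsurj.range_eq, Nat.card_univ, natCard_quotient_span_s10 hg,
      Nat.card_eq_fintype_card]

theorem pow_min_add_sum_Ico_pow {q D n : ℕ} (hq : 1 ≤ q) (hD : 1 ≤ D) (hn : 1 ≤ n) :
    q ^ min n D + (q - 1) * ∑ k ∈ Finset.Ico 1 n, q ^ k * (if D ≤ k then 1 else 0) = q ^ n := by
  induction n, hn using Nat.le_induction with
  | base => simp [hD]
  | succ n hn ih =>
    rw [Finset.sum_Ico_succ_top hn]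
    obtain ⟨p, rfl⟩ := Nat.exists_eq_add_of_le' hq
    rw [Nat.add_sub_cancel] at ih ⊢
    split_ifs with h
    · rw [min_eq_right h] at ih
      rw [min_eq_right (h.trans n.le_succ), mul_add, ← add_assoc, ih]
      ring
    · have h0 : ∑ k ∈ Finset.Ico 1 n, (p + 1) ^ k * (if D ≤ k then 1 else 0) = 0 := by
        refine Finset.sum_eq_zero fun k hk => ?_
        rw [Finset.mem_Ico] at hk
        rw [if_neg (by omega), mul_zero]
      rw [h0, min_eq_left (by omega)]
      simp

theorem sum_pow_min_add_sum_Ico_pow {q d n : ℕ} (hq : 1 ≤ q) (hd : 1 ≤ d) (hn : 1 ≤ n) (e : ℕ) :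
    ∑ i ∈ Finset.range e, q ^ min n ((i + 1) * d) +
      (q - 1) * ∑ k ∈ Finset.Ico 1 n, q ^ k * min e (k / d) = e * q ^ n := by
  induction e with
  | zero => simp
  | succ e ih =>
    have hmin : ∀ k, min (e + 1) (k / d) = min e (k / d) + if (e + 1) * d ≤ k then 1 else 0 := by
      intro k
      have := Nat.le_div_iff_mul_le (x := e + 1) (y := k) hd
      split_ifs <;> omega
    simp only [hmin, mul_add (q ^ _), Finset.sum_add_distrib]
    have h := pow_min_add_sum_Ico_pow hq (Nat.mul_pos e.succ_pos hd : 1 ≤ (e + 1) * d) hn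
    rw [Finset.sum_range_succ, mul_add (q - 1), add_mul e 1 (q ^ n), one_mul, ← ih, ← h]
    ac_rfl

/-- Lemma: counting congruence preserving functions `A_f → A_{P^e}`.
With `n = deg f`, `d = deg P`, the number `M(f, P^e)` of congruence preserving functions
satisfies `M(f, P^e) · |P|^{(q-1) Σ_{k=1}^{n-1} q^k min{e, ⌊k/d⌋}} = |P|^{e q^n}`,
i.e. `M(f, P^e) = q^{d (e q^n - (q-1) Σ_{k=1}^{n-1} q^k min{e, ⌊k/d⌋})}`. -/
theorem countCongPres_primePow (f P : Polynomial F) (hf : 1 ≤ f.natDegree)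
    (hPmonic : P.Monic) (hPirr : Irreducible P) (e : ℕ) (he : 1 ≤ e) :
    Nat.card {σ : (Polynomial F ⧸ Ideal.span {f}) → Polynomial F ⧸ Ideal.span {P ^ e} //
        IsCongPres f (P ^ e) σ} *
      (Fintype.card F) ^ (P.natDegree *
        ((Fintype.card F - 1) * ∑ k ∈ Finset.Ico 1 f.natDegree,
          (Fintype.card F) ^ k * min e (k / P.natDegree)))
    = (Fintype.card F) ^ (P.natDegree * (e * (Fintype.card F) ^ f.natDegree)) := by
  have hf0 : f ≠ 0 := by rintro rfl; simp at hf
  rw [Nat.card_congr (Equiv.subtypeEquivRight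
    (isCongPres_iff_isPowCongPres hf0 hPirr e))]
  have := finite_quotient_span_s10 hf0
  rw [natCard_isPowCongPres hPirr.ne_zero, ← pow_add, ← mul_add]
  simp only [natCard_range_mk_modRep hf0 (pow_ne_zero _ hPirr.ne_zero), natDegree_pow]
  rw [sum_pow_min_add_sum_Ico_pow Fintype.card_pos hPirr.natDegree_pos hf]
end
end

section
/- Let f, g ∈ A be non-constant with n = deg f. Then the number N(f, g) of polynomial functions from A_f to A_g equals q^{q^n · deg g} / ∏_{k=1}^{q^n−1} q^{deg gcd(g, ∏_{i=0}^{k−1}(a_k − a_i))}. -/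
open Polynomial

noncomputable section

variable {F : Type*} [Field F] [Fintype F]

/-- `a : ℕ → A` enumerates `A` following the `q`-adic expansion: `a 0 = 0`,
`a` restricted to `{0, …, q-1}` is a bijection onto the constants (i.e. onto `F_q`),
and `a k = Σ_i a_{l_i} t^i` where `k = Σ_i l_i q^i` is the `q`-adic expansion,
equivalently `a k = a (k % q) + X · a (k / q)`. -/
def IsASeq (a : ℕ → Polynomial F) : Prop :=
  a 0 = 0 ∧
  Set.BijOn a (Set.Iio (Fintype.card F)) (Set.range (Polynomial.C : F → Polynomial F)) ∧
  ∀ k : ℕ, a k = a (k % Fintype.card F) + Polynomial.X * a (k / Fintype.card F)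

theorem dvd_sub_mod_self {R : Type*} [EuclideanDomain R] (x h : R) : h ∣ x - x % h :=
  ⟨x / h, by linear_combination -EuclideanDomain.div_add_mod x h⟩

section Enumeration

theorem IsASeq.exists_eq_C {a : ℕ → F[X]} (ha : IsASeq a) {i : ℕ} (hi : i < Fintype.card F) :
    ∃ c : F, a i = C c := by
  obtain ⟨c, hc⟩ := ha.2.1.mapsTo (show i ∈ Set.Iio _ from hi)
  exact ⟨c, hc.symm⟩

theorem IsASeq.apply_mul_add {a : ℕ → F[X]} (ha : IsASeq a) (d j i : ℕ)
    (hi : i < Fintype.card F ^ d) :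
    a (Fintype.card F ^ d * j + i) = a i + X ^ d * a j := by
  have hq : 0 < Fintype.card F := Fintype.card_pos
  induction d generalizing i with
  | zero =>
    obtain rfl : i = 0 := by simpa using hi
    simp [ha.1]
  | succ d ih =>
    have hdiv : i / Fintype.card F < Fintype.card F ^ d :=
      Nat.div_lt_of_lt_mul (by rwa [pow_succ'] at hi)
    have heq : Fintype.card F ^ (d + 1) * j + i
        = i + Fintype.card F * (Fintype.card F ^ d * j) := by ring
    rw [ha.2.2 (_ + i), ha.2.2 i, heq, Nat.add_mul_mod_self_left, Nat.add_mul_div_left _ _ hq,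
      add_comm (i / _), ih _ hdiv]
    ring

theorem IsASeq.degree_lt {a : ℕ → F[X]} (ha : IsASeq a) (d i : ℕ)
    (hi : i < Fintype.card F ^ d) : (a i).degree < d := by
  have hq : 0 < Fintype.card F := Fintype.card_pos
  induction d generalizing i with
  | zero =>
    obtain rfl : i = 0 := by simpa using hi
    simp [ha.1]
  | succ d ih =>
    have hdiv := ih (i / Fintype.card F) (Nat.div_lt_of_lt_mul (by rwa [pow_succ'] at hi))
    obtain ⟨c, hc⟩ := ha.exists_eq_C (Nat.mod_lt i hq)
    rw [← mem_degreeLT, mem_degreeLT, degree_lt_iff_coeff_zero] at *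
    intro m hm
    rw [ha.2.2 i, hc]
    obtain ⟨m, rfl⟩ : ∃ m', m = m' + 1 := ⟨m - 1, by omega⟩
    simp [hdiv m (by omega)]

theorem IsASeq.exists_apply_eq {a : ℕ → F[X]} (ha : IsASeq a) (d : ℕ) (h : F[X])
    (hh : h.degree < d) : ∃ i < Fintype.card F ^ d, a i = h := by
  have hq : 0 < Fintype.card F := Fintype.card_pos
  induction d generalizing h with
  | zero =>
    refine ⟨0, by simp, ?_⟩
    rw [ha.1, eq_comm, ← degree_eq_bot]
    exact Nat.WithBot.lt_zero_iff.mp hh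
  | succ d ih =>
    have hdiv : h.divX.degree < d := by
      rw [degree_lt_iff_coeff_zero] at hh ⊢
      intro m hm
      rw [coeff_divX]
      exact hh _ (by omega)
    obtain ⟨j, hj, hj'⟩ := ih _ hdiv
    obtain ⟨i, hi, hi'⟩ := ha.2.1.surjOn (Set.mem_range_self (h.coeff 0))
    have hi : i < Fintype.card F := hi
    refine ⟨i + Fintype.card F * j, ?_, ?_⟩
    · calc i + Fintype.card F * j < Fintype.card F * (j + 1) := by rw [mul_add]; omega
        _ ≤ Fintype.card F ^ (d + 1) := by
          rw [pow_succ']; exact Nat.mul_le_mul_left _ hj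
    · rw [ha.2.2, Nat.add_mul_mod_self_left, Nat.add_mul_div_left _ _ hq, Nat.mod_eq_of_lt hi,
        Nat.div_eq_of_lt hi, zero_add, hi', hj', add_comm, mul_comm,
        divX_mul_X_add]

theorem IsASeq.injective {a : ℕ → F[X]} (ha : IsASeq a) : Function.Injective a := by
  have hq : 1 < Fintype.card F := Fintype.one_lt_card
  have key : ∀ d : ℕ, Set.InjOn a (Set.Iio (Fintype.card F ^ d)) := by
    intro d
    induction d with
    | zero =>
      intro i hi j hj _
      simp only [pow_zero, Set.mem_Iio] at hi hj
      omega
    | succ d ih =>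
      intro i hi j hj hij
      simp only [Set.mem_Iio, pow_succ'] at hi hj
      rw [ha.2.2 i, ha.2.2 j] at hij
      obtain ⟨c, hc⟩ := ha.exists_eq_C (Nat.mod_lt i (by omega))
      obtain ⟨e, he⟩ := ha.exists_eq_C (Nat.mod_lt j (by omega))
      have h0 : c = e := by simpa [hc, he] using congrArg (coeff · 0) hij
      subst h0
      have hmod := ha.2.1.injOn (Set.mem_Iio.mpr (Nat.mod_lt i (by omega)))
        (Set.mem_Iio.mpr (Nat.mod_lt j (by omega))) (hc.trans he.symm)
      rw [hmod] at hij
      have hdiv := ih (Nat.div_lt_of_lt_mul hi) (Nat.div_lt_of_lt_mul hj)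
        (mul_left_cancel₀ X_ne_zero (add_left_cancel hij))
      rw [← Nat.mod_add_div i (Fintype.card F), ← Nat.mod_add_div j (Fintype.card F), hmod, hdiv]
  intro i j hij
  have hlt := Nat.lt_pow_self hq (n := max i j)
  exact key (max i j) (Set.mem_Iio.mpr (by omega)) (Set.mem_Iio.mpr (by omega)) hij

open scoped Classical in
/-- Among the first `k` terms, at most `⌊k / q ^ deg h⌋` are congruent to `a k` modulo `h`. -/
theorem IsASeq.card_dvd_sub_self_le {a : ℕ → F[X]} (ha : IsASeq a) {h : F[X]} (hh : h ≠ 0)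
    (k : ℕ) :
    ((Finset.range k).filter fun i => h ∣ a k - a i).card
      ≤ k / Fintype.card F ^ h.natDegree := by
  set M := Fintype.card F ^ h.natDegree with hM
  have hMpos : 0 < M := pow_pos Fintype.card_pos _
  have hsep : ∀ i j : ℕ, h ∣ a i - a j → i / M = j / M → i = j := by
    intro i j hdvd hij
    have hdi := ha.apply_mul_add h.natDegree (i / M) (i % M) (Nat.mod_lt _ hMpos)
    have hdj := ha.apply_mul_add h.natDegree (j / M) (j % M) (Nat.mod_lt _ hMpos)
    rw [← hM, Nat.div_add_mod] at hdi hdj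
    apply ha.injective
    rw [← sub_eq_zero]
    refine eq_zero_of_dvd_of_degree_lt hdvd ?_
    rw [hdi, hdj, hij, add_sub_add_right_eq_sub, degree_eq_natDegree hh]
    exact (degree_sub_le _ _).trans_lt (max_lt (ha.degree_lt _ _ (Nat.mod_lt _ hMpos))
      (ha.degree_lt _ _ (Nat.mod_lt _ hMpos)))
  rw [← Finset.card_range (k / M)]
  refine Finset.card_le_card_of_injOn (· / M) ?_ ?_
  · intro i hi
    simp only [Finset.coe_filter, Finset.mem_range, Set.mem_ofPred_eq, Finset.coe_range,
      Set.mem_Iio] at hi ⊢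
    refine lt_of_le_of_ne (Nat.div_le_div_right hi.1.le) fun heq => ?_
    exact hi.1.ne' (hsep k i hi.2 heq.symm)
  · intro i hi j hj hij
    simp only [Finset.coe_filter, Finset.mem_range, Set.mem_ofPred_eq] at hi hj
    refine hsep i j ?_ hij
    have := dvd_sub hj.2 hi.2
    rwa [sub_sub_sub_cancel_left] at this

open scoped Classical in
/-- Among the first `k` terms, at least `⌊k / q ^ deg h⌋` are congruent to `x` modulo `h`. -/
theorem IsASeq.le_card_dvd_sub {a : ℕ → F[X]} (ha : IsASeq a) {h : F[X]} (hh : h ≠ 0)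
    (k : ℕ) (x : F[X]) :
    k / Fintype.card F ^ h.natDegree
      ≤ ((Finset.range k).filter fun i => h ∣ x - a i).card := by
  set M := Fintype.card F ^ h.natDegree with hM
  have hMpos : 0 < M := pow_pos Fintype.card_pos _
  have hblock : ∀ j : ℕ, ∃ i < M, h ∣ x - a (M * j + i) := by
    intro j
    obtain ⟨i, hi, hi'⟩ := ha.exists_apply_eq h.natDegree ((x - X ^ h.natDegree * a j) % h)
      (by rw [← degree_eq_natDegree hh]; exact EuclideanDomain.mod_lt _ hh)
    refine ⟨i, hi, ?_⟩
    rw [ha.apply_mul_add _ _ _ hi, hi', ← sub_sub, sub_right_comm]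
    exact dvd_sub_mod_self _ _
  choose r hr hdvd using hblock
  rw [← Finset.card_range (k / M)]
  refine Finset.card_le_card_of_injOn (fun j => M * j + r j) ?_ ?_
  · intro j hj
    simp only [Finset.coe_filter, Finset.mem_range, Set.mem_ofPred_eq, Finset.coe_range,
      Set.mem_Iio] at hj ⊢
    refine ⟨?_, hdvd j⟩
    calc M * j + r j < M * (j + 1) := by rw [mul_add]; have := hr j; omega
      _ ≤ M * (k / M) := Nat.mul_le_mul_left _ hj
      _ ≤ k := Nat.mul_div_le k M
  · intro i _ j _ hij
    have := congrArg (· / M) hij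
    simpa [Nat.mul_add_div hMpos, Nat.div_eq_of_lt (hr _)] using this

end Enumeration

section Divisibility

variable {R : Type*} [CommRing R] [IsDomain R] [UniqueFactorizationMonoid R]

open scoped Classical in
theorem multiplicity_eq_card_pow_dvd_of_prime {p y : R} (hp : Prime p) (hy : y ≠ 0) {B : ℕ}
    (hB : multiplicity p y ≤ B) :
    multiplicity p y = ((Finset.Icc 1 B).filter fun e => p ^ e ∣ y).card := by
  have hfin := FiniteMultiplicity.of_prime_left hp hy
  have : (Finset.Icc 1 B).filter (fun e => p ^ e ∣ y) = Finset.Icc 1 (multiplicity p y) := by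
    ext e
    rw [Finset.mem_filter, hfin.pow_dvd_iff_le_multiplicity, Finset.mem_Icc, Finset.mem_Icc]
    omega
  rw [this, Nat.card_Icc, Nat.add_sub_cancel]

open scoped Classical in
/-- If every nonzero `h` divides at least as many of the `v i` as of the `u i`, then the product
of the `u i` divides the product of the `v i`. -/
theorem prod_dvd_prod_of_card_dvd_le {ι : Type*} (s : Finset ι) (u v : ι → R)
    (hu : ∀ i ∈ s, u i ≠ 0)
    (huv : ∀ h : R, h ≠ 0 → (s.filter fun i => h ∣ u i).card ≤ (s.filter fun i => h ∣ v i).card) :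
    ∏ i ∈ s, u i ∣ ∏ i ∈ s, v i := by
  by_cases hv : ∀ i ∈ s, v i ≠ 0
  swap
  · push Not at hv
    obtain ⟨i, hi, hi'⟩ := hv
    rw [Finset.prod_eq_zero hi hi']
    exact dvd_zero _
  rw [UniqueFactorizationMonoid.dvd_iff_emultiplicity_le (Finset.prod_ne_zero_iff.mpr hu)]
  intro p hp
  rw [Finset.emultiplicity_prod hp, Finset.emultiplicity_prod hp]
  set B := s.sup (fun i => multiplicity p (u i)) + s.sup (fun i => multiplicity p (v i)) with hB
  have hcount : ∀ w : ι → R, (∀ i ∈ s, w i ≠ 0) → (∀ i ∈ s, multiplicity p (w i) ≤ B) →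
      ∑ i ∈ s, emultiplicity p (w i)
        = ((∑ e ∈ Finset.Icc 1 B, (s.filter fun i => p ^ e ∣ w i).card : ℕ) : ℕ∞) := by
    intro w hw hwB
    have hswap : ∑ e ∈ Finset.Icc 1 B, (s.filter fun i => p ^ e ∣ w i).card
        = ∑ i ∈ s, ((Finset.Icc 1 B).filter fun e => p ^ e ∣ w i).card := by
      simp only [Finset.card_filter]
      exact Finset.sum_comm
    rw [hswap, Nat.cast_sum]
    refine Finset.sum_congr rfl fun i hi => ?_
    rw [(FiniteMultiplicity.of_prime_left hp (hw i hi)).emultiplicity_eq_multiplicity,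
      multiplicity_eq_card_pow_dvd_of_prime hp (hw i hi) (hwB i hi)]
  rw [hcount u hu fun i hi => ?_, hcount v hv fun i hi => ?_]
  · exact_mod_cast Finset.sum_le_sum fun e _ => huv _ (pow_ne_zero e hp.ne_zero)
  · exact (Finset.le_sup (f := fun i => multiplicity p (v i)) hi).trans (Nat.le_add_left _ _)
  · exact (Finset.le_sup (f := fun i => multiplicity p (u i)) hi).trans (Nat.le_add_right _ _)

end Divisibility

theorem IsASeq.prod_sub_self_dvd {a : ℕ → F[X]} (ha : IsASeq a) (k : ℕ) (x : F[X]) :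
    ∏ i ∈ Finset.range k, (a k - a i) ∣ ∏ i ∈ Finset.range k, (x - a i) := by
  classical
  refine prod_dvd_prod_of_card_dvd_le _ _ _ (fun i hi => ?_) fun h hh =>
    (ha.card_dvd_sub_self_le hh k).trans (ha.le_card_dvd_sub hh k x)
  exact sub_ne_zero.mpr (ha.injective.ne (Finset.mem_range.mp hi).ne')

section Card

theorem natCard_quotient_span_singleton {h : F[X]} (hh : h ≠ 0) :
    Nat.card (F[X] ⧸ Ideal.span {h}) = Fintype.card F ^ h.natDegree := by
  have : Module.Finite F (F[X] ⧸ Ideal.span {h}) :=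
    (AdjoinRoot.powerBasis hh).finite
  rw [Module.natCard_eq_pow_finrank (K := F), finrank_quotient_span_eq_natDegree,
    Nat.card_eq_fintype_card]

theorem finite_quotient_span_singleton {h : F[X]} (hh : h ≠ 0) :
    Finite (F[X] ⧸ Ideal.span {h}) :=
  Nat.finite_of_card_ne_zero (by
    rw [natCard_quotient_span_singleton hh]
    exact pow_ne_zero _ Fintype.card_ne_zero)

/-- In a finite commutative ring, the annihilator of `r` has as many elements as the quotient by
the ideal generated by `r`. -/
theorem natCard_mul_eq_zero {R : Type*} [CommRing R] [Finite R] (r : R) :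
    Nat.card {c : R // c * r = 0} = Nat.card (R ⧸ Ideal.span {r}) := by
  let φ := AddMonoidHom.mulRight r
  have hker := φ.ker.card_mul_index
  rw [AddSubgroup.index_ker] at hker
  have hrange : φ.range = (Ideal.span {r}).toAddSubgroup := by
    ext x
    simp [φ, Ideal.mem_span_singleton', AddMonoidHom.mem_range]
  have hquot := (Ideal.span {r}).toAddSubgroup.card_mul_index
  rw [hrange] at hker
  have hpos : 0 < Nat.card (Ideal.span {r}).toAddSubgroup := Nat.card_pos
  have heq : Nat.card φ.ker = (Ideal.span {r}).toAddSubgroup.index :=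
    Nat.eq_of_mul_eq_mul_left hpos (by rw [hquot, mul_comm, hker])
  exact heq

theorem natCard_mul_mk_eq_zero [DecidableEq F[X]] {g : F[X]} (hg : g ≠ 0) (p : F[X]) :
    Nat.card {c : F[X] ⧸ Ideal.span {g} // c * Ideal.Quotient.mk (Ideal.span {g}) p = 0}
      = Fintype.card F ^ (EuclideanDomain.gcd g p).natDegree := by
  have := finite_quotient_span_singleton hg
  rw [natCard_mul_eq_zero,
    ← natCard_quotient_span_singleton fun h => hg (EuclideanDomain.gcd_eq_zero_iff.mp h).1]
  have hmap : Ideal.span {Ideal.Quotient.mk (Ideal.span {g}) p}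
      = (Ideal.span {p}).map (Ideal.Quotient.mk (Ideal.span {g})) := by
    rw [Ideal.map_span, Set.image_singleton]
  have hsup : Ideal.span {g} ⊔ Ideal.span {p} = Ideal.span {EuclideanDomain.gcd g p} := by
    rw [EuclideanDomain.span_gcd, Ideal.span_insert]
  exact Nat.card_congr (((Ideal.quotEquivOfEq hmap).trans
    (DoubleQuot.quotQuotEquivQuotSup _ _)).trans (Ideal.quotEquivOfEq hsup)).toEquiv

end Card

section Newton

theorem exists_newton_expansion {R : Type*} [CommRing R] (a : ℕ → R) (G : R[X]) (m : ℕ) :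
    ∃ (c : ℕ → R) (Q : R[X]), ∀ x, G.eval x
      = ∑ k ∈ Finset.range m, c k * ∏ i ∈ Finset.range k, (x - a i)
        + (∏ i ∈ Finset.range m, (x - a i)) * Q.eval x := by
  induction m with
  | zero => exact ⟨0, G, by simp⟩
  | succ m ih =>
    obtain ⟨c, Q, h⟩ := ih
    obtain ⟨S, hS⟩ := X_sub_C_dvd_sub_C_eval (a := a m) (p := Q)
    refine ⟨fun k => if k < m then c k else Q.eval (a m), S, fun x => ?_⟩
    have hQ : Q.eval x = Q.eval (a m) + (x - a m) * S.eval x := by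
      have := congrArg (eval x) hS
      simp only [eval_sub, eval_C, eval_mul, eval_X] at this
      linear_combination this
    rw [h, Finset.sum_range_succ, Finset.prod_range_succ, hQ]
    have hsum : ∑ k ∈ Finset.range m, (if k < m then c k else Q.eval (a m)) *
          ∏ i ∈ Finset.range k, (x - a i)
        = ∑ k ∈ Finset.range m, c k * ∏ i ∈ Finset.range k, (x - a i) :=
      Finset.sum_congr rfl fun k hk => by rw [if_pos (Finset.mem_range.mp hk)]
    simp only [hsum, lt_irrefl, if_false]
    ring

/-- The map sending the coefficients of a Newton expansion with nodes `a i` to the function that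
the expansion defines from `ι` to `R ⧸ I`, the element `s : ι` being represented by `r s`. -/
def newtonEval {R ι : Type*} [CommRing R] (I : Ideal R) (a : ℕ → R) (r : ι → R) (m : ℕ) :
    (Fin m → R ⧸ I) →+ (ι → R ⧸ I) where
  toFun c s := ∑ k : Fin m, c k * Ideal.Quotient.mk I (∏ i ∈ Finset.range k, (r s - a i))
  map_zero' := by ext; simp
  map_add' c d := by ext; simp [add_mul, Finset.sum_add_distrib]

theorem newtonEval_apply {R ι : Type*} [CommRing R] (I : Ideal R) (a : ℕ → R) (r : ι → R) (m : ℕ)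
    (c : Fin m → R ⧸ I) (s : ι) :
    newtonEval I a r m c s =
      ∑ k : Fin m, c k * Ideal.Quotient.mk I (∏ i ∈ Finset.range k, (r s - a i)) := rfl

end Newton

theorem mem_ker_newtonEval_iff {ι : Type*} (g : F[X]) {a : ℕ → F[X]} (ha : IsASeq a)
    (r : ι → F[X]) (m : ℕ) (hr : ∀ j < m, ∃ s, r s = a j)
    (c : Fin m → F[X] ⧸ Ideal.span {g}) :
    c ∈ (newtonEval (Ideal.span {g}) a r m).ker ↔
      ∀ k : Fin m, c k * Ideal.Quotient.mk (Ideal.span {g})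
        (∏ i ∈ Finset.range k, (a k - a i)) = 0 := by
  have hdvd : ∀ (k : Fin m) (x : F[X]), c k * Ideal.Quotient.mk (Ideal.span {g})
      (∏ i ∈ Finset.range k, (a k - a i)) = 0 → c k * Ideal.Quotient.mk (Ideal.span {g})
      (∏ i ∈ Finset.range k, (x - a i)) = 0 := by
    intro k x h
    obtain ⟨y, hy⟩ := ha.prod_sub_self_dvd k x
    rw [hy, map_mul, ← mul_assoc, h, zero_mul]
  rw [AddMonoidHom.mem_ker]
  constructor
  · intro h
    have key : ∀ (j : ℕ) (hj : j < m), c ⟨j, hj⟩ * Ideal.Quotient.mk (Ideal.span {g})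
        (∏ i ∈ Finset.range j, (a j - a i)) = 0 := by
      intro j
      induction j using Nat.strong_induction_on with
      | _ j ih =>
        intro hj
        obtain ⟨s, hs⟩ := hr j hj
        have hz := congrFun h s
        rw [newtonEval_apply, Finset.sum_eq_single ⟨j, hj⟩, hs] at hz
        · exact hz
        · intro k _ hk
          rcases lt_or_gt_of_ne (Fin.val_ne_of_ne hk) with hlt | hgt
          · exact hdvd k _ (ih k hlt k.2)
          · rw [hs, Finset.prod_eq_zero (Finset.mem_range.mpr hgt) (sub_self _), map_zero,
              mul_zero]
        · simp
    exact fun k => key k k.2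
  · intro h
    ext s
    rw [newtonEval_apply]
    exact Finset.sum_eq_zero fun k _ => hdvd k _ (h k)

theorem mem_range_newtonEval_iff (f g : F[X]) (hf : f ≠ 0) {a : ℕ → F[X]} (ha : IsASeq a)
    (r : F[X] ⧸ Ideal.span {f} → F[X])
    (hr : ∀ h : F[X], h.degree < f.degree → r (Ideal.Quotient.mk _ h) = h)
    (σ : F[X] ⧸ Ideal.span {f} → F[X] ⧸ Ideal.span {g}) :
    σ ∈ (newtonEval (Ideal.span {g}) a r (Fintype.card F ^ f.natDegree)).range ↔ IsPolyFun f g σ := by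
  constructor
  · rintro ⟨c, rfl⟩
    choose d hd using fun k => Ideal.Quotient.mk_surjective (c k)
    refine ⟨∑ k, C (d k) * ∏ i ∈ Finset.range k, (X - C (a i)), fun h hh => ?_⟩
    simp only [newtonEval_apply, hr h hh, eval_finsetSum, eval_mul, eval_C, eval_prod, eval_sub,
      eval_X, map_sum, map_mul, hd]
  · rintro ⟨G, hG⟩
    obtain ⟨c, Q, hc⟩ := exists_newton_expansion a G (Fintype.card F ^ f.natDegree)
    refine ⟨fun k => Ideal.Quotient.mk _ (c k), ?_⟩
    ext s
    obtain ⟨h, hh, rfl⟩ : ∃ h : F[X], h.degree < f.degree ∧ Ideal.Quotient.mk _ h = s := by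
      obtain ⟨y, rfl⟩ := Ideal.Quotient.mk_surjective s
      refine ⟨y % f, EuclideanDomain.mod_lt _ hf, ?_⟩
      rw [Ideal.Quotient.eq, Ideal.mem_span_singleton, dvd_sub_comm]
      exact dvd_sub_mod_self _ _
    obtain ⟨j, hj, rfl⟩ := ha.exists_apply_eq f.natDegree h (by rwa [← degree_eq_natDegree hf])
    rw [newtonEval_apply, hr _ hh, hG _ hh, hc, Finset.prod_eq_zero (Finset.mem_range.mpr hj)
      (sub_self _), zero_mul, add_zero, map_sum, Finset.sum_range]
    simp only [map_mul]

open scoped Classical in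
/-- Theorem: counting polynomial functions.
With `n = deg f`, the number `N(f,g)` of polynomial functions `A_f → A_g` satisfies
`N(f,g) · ∏_{k=1}^{q^n - 1} q^{deg gcd(g, ∏_{i<k}(a_k - a_i))} = q^{q^n · deg g}`. -/
theorem countPolyFun (f g : Polynomial F) (hf : 1 ≤ f.natDegree) (hg' : 1 ≤ g.natDegree)
    (a : ℕ → Polynomial F) (ha : IsASeq a) :
    Nat.card {σ : (Polynomial F ⧸ Ideal.span {f}) → Polynomial F ⧸ Ideal.span {g} //
        IsPolyFun f g σ} *
      ∏ k ∈ Finset.Ico 1 (Fintype.card F ^ f.natDegree),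
        (Fintype.card F) ^
          (EuclideanDomain.gcd g (∏ i ∈ Finset.range k, (a k - a i))).natDegree
    = (Fintype.card F) ^ ((Fintype.card F) ^ f.natDegree * g.natDegree) := by
  have hf0 : f ≠ 0 := ne_zero_of_natDegree_gt hf
  have hg0 : g ≠ 0 := ne_zero_of_natDegree_gt hg'
  have := finite_quotient_span_singleton hg0
  set m := Fintype.card F ^ f.natDegree
  obtain ⟨r, hr⟩ : ∃ r : F[X] ⧸ Ideal.span {f} → F[X],
      ∀ h : F[X], h.degree < f.degree → r (Ideal.Quotient.mk _ h) = h := by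
    refine ⟨fun s => s.out % f, fun h hh => ?_⟩
    have hmk : Ideal.Quotient.mk (Ideal.span {f}) (Quotient.out (Ideal.Quotient.mk _ h))
        = Ideal.Quotient.mk _ h := Ideal.Quotient.mk_out _
    rw [Ideal.Quotient.eq, Ideal.mem_span_singleton] at hmk
    rw [← sub_eq_zero]
    refine eq_zero_of_dvd_of_degree_lt ?_ ((degree_sub_le _ _).trans_lt
      (max_lt (EuclideanDomain.mod_lt _ hf0) hh))
    rw [← sub_sub_sub_cancel_left _ _ (Quotient.out (Ideal.Quotient.mk (Ideal.span {f}) h)),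
      dvd_sub_comm]
    exact dvd_sub (dvd_sub_mod_self _ _) hmk
  have hnode : ∀ j < m, ∃ s, r s = a j := fun j hj =>
    ⟨_, hr _ (by rw [degree_eq_natDegree hf0]; exact ha.degree_lt _ _ hj)⟩
  have hcard := (newtonEval (Ideal.span {g}) a r m).ker.card_mul_index
  have hker : Nat.card (newtonEval (Ideal.span {g}) a r m).ker = ∏ k ∈ Finset.range m, Fintype.card F ^
      (EuclideanDomain.gcd g (∏ i ∈ Finset.range k, (a k - a i))).natDegree := by
    rw [Nat.card_congr ((Equiv.subtypeEquivRight
      (mem_ker_newtonEval_iff g ha r m hnode)).trans (Equiv.subtypePiEquivPi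
        (p := fun (k : Fin m) x => x * Ideal.Quotient.mk (Ideal.span {g})
          (∏ i ∈ Finset.range k, (a k - a i)) = 0))), Nat.card_pi,
      Finset.prod_range]
    exact Finset.prod_congr rfl fun k _ => natCard_mul_mk_eq_zero hg0 _
  have hrange : Nat.card (newtonEval (Ideal.span {g}) a r m).range = Nat.card {σ // IsPolyFun f g σ} :=
    Nat.card_congr (Equiv.subtypeEquivRight (mem_range_newtonEval_iff f g hf0 ha r hr))
  have hdom : Nat.card (Fin m → F[X] ⧸ Ideal.span {g})
      = Fintype.card F ^ (m * g.natDegree) := by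
    rw [Nat.card_fun, natCard_quotient_span_singleton hg0, Nat.card_fin, ← pow_mul, mul_comm]
  have hzero : Fintype.card F ^
      (EuclideanDomain.gcd g (∏ i ∈ Finset.range 0, (a 0 - a i))).natDegree = 1 := by
    rw [Finset.prod_range_zero, natDegree_eq_zero_of_isUnit
      (isUnit_of_dvd_one (EuclideanDomain.gcd_dvd_right g 1)), pow_zero]
  rw [AddSubgroup.index_ker, hker, hrange, hdom, Finset.range_eq_Ico,
    Finset.prod_eq_prod_Ico_succ_bot (pow_pos Fintype.card_pos _), hzero, one_mul] at hcard
  rw [mul_comm, hcard]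
end
end
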